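/- arXiv:1204.6697 — 6 statements merged into one kernel-verified Lean document; each statement's English description precedes it below -/
import Mathlib

section
/- The Bianchi group PSL₂(ℤ[i]) admits the presentation ⟨a, b, c, d | a³ = b² = c³ = d² = (ac)² = (ad)² = (bc)² = (bd)² = 1⟩; that is, PSL₂(ℤ[i]) is isomorphic to the group presented by four generators a, b, c, d subject to the relators a³, b², c³, d², (ac)², (ad)², (bc)², (bd)². -/
/-- `SL₂(R)`: the special linear group of 2×2 matrices over `R` of determinant 1. -/
abbrev SL2 (R : Type*) [CommRing R] : Type _ :=
  Matrix.SpecialLinearGroup (Fin 2) R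

/-- `PSL₂(R)`: the quotient of `SL₂(R)` by its center. -/
abbrev PSL2 (R : Type*) [CommRing R] : Type _ :=
  SL2 R ⧸ Subgroup.center (SL2 R)

namespace Bianchi

abbrev R := GaussianInt

def I' : R := ⟨0, 1⟩

def TT (q : R) : SL2 R := ⟨!![1, q; 0, 1], by simp [Matrix.det_fin_two]⟩
def SS : SL2 R := ⟨!![0, -1; 1, 0], by simp [Matrix.det_fin_two]⟩
def LL : SL2 R := ⟨!![I', 0; 0, -I'], by simp [Matrix.det_fin_two]; decide⟩

theorem mul_ap (A B : SL2 R) (i j : Fin 2) :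
    (A * B) i j = A i 0 * B 0 j + A i 1 * B 1 j := by
  rw [Matrix.SpecialLinearGroup.coe_mul, Matrix.mul_apply, Fin.sum_univ_two]

theorem neg_app (M : SL2 R) (i j : Fin 2) : (-M) i j = - M i j := by
  simp

theorem sl_ext (A B : SL2 R) (h0 : A 0 0 = B 0 0) (h1 : A 0 1 = B 0 1) (h2 : A 1 0 = B 1 0)
    (h3 : A 1 1 = B 1 1) : A = B := by
  apply Matrix.SpecialLinearGroup.ext
  intro i j
  fin_cases i <;> fin_cases j <;> assumption

theorem eT00 (q : R) : (TT q) 0 0 = 1 := rfl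
theorem eT01 (q : R) : (TT q) 0 1 = q := rfl
theorem eT10 (q : R) : (TT q) 1 0 = 0 := rfl
theorem eT11 (q : R) : (TT q) 1 1 = 1 := rfl
theorem eS00 : SS 0 0 = 0 := rfl
theorem eS01 : SS 0 1 = -1 := rfl
theorem eS10 : SS 1 0 = 1 := rfl
theorem eS11 : SS 1 1 = 0 := rfl
theorem eL00 : LL 0 0 = I' := rfl
theorem eL01 : LL 0 1 = 0 := rfl
theorem eL10 : LL 1 0 = 0 := rfl
theorem eL11 : LL 1 1 = -I' := rfl
theorem e100 : (1 : SL2 R) 0 0 = 1 := rfl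
theorem e101 : (1 : SL2 R) 0 1 = 0 := rfl
theorem e110 : (1 : SL2 R) 1 0 = 0 := rfl
theorem e111 : (1 : SL2 R) 1 1 = 1 := rfl

theorem I_sq : I' * I' = -1 := by decide

theorem TT00 (q : R) (M : SL2 R) : (TT q * M) 0 0 = M 0 0 + q * M 1 0 := by
  rw [mul_ap, eT00, eT01]; ring
theorem TT01 (q : R) (M : SL2 R) : (TT q * M) 0 1 = M 0 1 + q * M 1 1 := by
  rw [mul_ap, eT00, eT01]; ring
theorem TT10 (q : R) (M : SL2 R) : (TT q * M) 1 0 = M 1 0 := by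
  rw [mul_ap, eT10, eT11]; ring
theorem TT11 (q : R) (M : SL2 R) : (TT q * M) 1 1 = M 1 1 := by
  rw [mul_ap, eT10, eT11]; ring
theorem SS00 (M : SL2 R) : (SS * M) 0 0 = - M 1 0 := by
  rw [mul_ap, eS00, eS01]; ring
theorem SS01 (M : SL2 R) : (SS * M) 0 1 = - M 1 1 := by
  rw [mul_ap, eS00, eS01]; ring
theorem SS10 (M : SL2 R) : (SS * M) 1 0 = M 0 0 := by
  rw [mul_ap, eS10, eS11]; ring
theorem SS11 (M : SL2 R) : (SS * M) 1 1 = M 0 1 := by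
  rw [mul_ap, eS10, eS11]; ring
theorem LL00 (M : SL2 R) : (LL * M) 0 0 = I' * M 0 0 := by
  rw [mul_ap, eL00, eL01]; ring
theorem LL01 (M : SL2 R) : (LL * M) 0 1 = I' * M 0 1 := by
  rw [mul_ap, eL00, eL01]; ring
theorem LL10 (M : SL2 R) : (LL * M) 1 0 = -(I' * M 1 0) := by
  rw [mul_ap, eL10, eL11]; ring
theorem LL11 (M : SL2 R) : (LL * M) 1 1 = -(I' * M 1 1) := by
  rw [mul_ap, eL10, eL11]; ring

theorem TT_add (p q : R) : TT (p + q) = TT p * TT q := by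
  apply sl_ext <;> simp only [mul_ap, eT00, eT01, eT10, eT11] <;> ring
theorem TT_zero : TT 0 = 1 := by
  apply sl_ext <;> rfl
theorem SS_sq : SS * SS = -1 := by
  apply sl_ext <;> simp only [mul_ap, neg_app, eS00, eS01, eS10, eS11, e100, e101, e110, e111] <;> ring
theorem LL_sq : LL * LL = -1 := by
  apply sl_ext <;> simp only [mul_ap, neg_app, eL00, eL01, eL10, eL11, e100, e101, e110, e111] <;>
    decide
theorem SSLL : SS * LL = - (LL * SS) := by
  apply sl_ext <;> simp only [mul_ap, neg_app, eL00, eL01, eL10, eL11, eS00, eS01, eS10, eS11] <;> ring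
theorem TTLL (q : R) : TT q * LL = LL * TT (-q) := by
  apply sl_ext <;> simp only [mul_ap, eL00, eL01, eL10, eL11, eT00, eT01, eT10, eT11] <;> ring

/-- Abstract data. -/
structure BD (G : Type*) [Group G] where
  S : G
  L : G
  t : R → G
  S2 : S * S = 1
  L2 : L * L = 1
  SL : S * L = L * S
  tadd : ∀ p q, t (p + q) = t p * t q
  Lt : ∀ q, L * t q = t (-q) * L
  r1 : S * t 1 * S = t (-1) * S * t (-1)
  ri : S * t I' * S = t I' * S * L * t I'

variable {G : Type*} [Group G] (B : BD G)

theorem BD.t0 : B.t 0 = 1 := by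
  have := B.tadd 0 0
  simpa using this

theorem BD.tneg (q : R) : B.t (-q) = (B.t q)⁻¹ := by
  rw [eq_inv_iff_mul_eq_one, ← B.tadd]; simp [B.t0]

theorem BD.Sinv : B.S⁻¹ = B.S := by
  rw [inv_eq_iff_mul_eq_one]; exact B.S2
theorem BD.Linv : B.L⁻¹ = B.L := by
  rw [inv_eq_iff_mul_eq_one]; exact B.L2

theorem BD.r1n : B.S * B.t (-1) * B.S = B.t 1 * B.S * B.t 1 := by
  have := congrArg (·⁻¹) B.r1
  simp only [mul_inv_rev, B.Sinv, ← B.tneg, neg_neg] at this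
  simpa [mul_assoc] using this

theorem BD.rin : B.S * B.t (-I') * B.S = B.t (-I') * B.S * B.L * B.t (-I') := by
  have := congrArg (·⁻¹) B.ri
  simp only [mul_inv_rev, B.Sinv, B.Linv, ← B.tneg] at this
  rw [mul_assoc (B.t (-I')) B.S, B.SL]
  simpa [mul_assoc] using this

theorem norm_mod_lt (x y : R) (h : y ≠ 0) :
    (x - (x / y) * y).norm.natAbs < y.norm.natAbs := by
  have := GaussianInt.natAbs_norm_mod_lt x h
  rwa [EuclideanDomain.mod_eq_sub_mul_div, mul_comm] at this

theorem dec10 (q : R) (M : SL2 R) : (SS * (TT (-q) * M)) 1 0 = M 0 0 - q * M 1 0 := by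
  rw [SS10, TT00]; ring

noncomputable def sig (M : SL2 R) : G :=
  if h : M 1 0 = 0 then B.t (M 0 1 * M 0 0) * (if (M 0 0).re = 0 then B.L else 1)
  else B.t (M 0 0 / M 1 0) * B.S * sig (SS * (TT (-(M 0 0 / M 1 0)) * M))
termination_by (M 1 0).norm.natAbs
decreasing_by
  rw [dec10]
  exact norm_mod_lt _ _ h

theorem sig_base (M : SL2 R) (h : M 1 0 = 0) :
    sig B M = B.t (M 0 1 * M 0 0) * (if (M 0 0).re = 0 then B.L else 1) := by
  rw [sig, dif_pos h]
theorem sig_step (M : SL2 R) (h : M 1 0 ≠ 0) :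
    sig B M = B.t (M 0 0 / M 1 0) * B.S * sig B (SS * (TT (-(M 0 0 / M 1 0)) * M)) := by
  rw [sig, dif_neg h]

theorem det_eq (M : SL2 R) : M 0 0 * M 1 1 - M 0 1 * M 1 0 = 1 := by
  have := M.det_coe
  rwa [Matrix.det_fin_two] at this

theorem unit_cases (u : R) (h : u.norm = 1) : u = 1 ∨ u = -1 ∨ u = I' ∨ u = -I' := by
  rw [Zsqrtd.norm_def] at h
  obtain ⟨a, b⟩ := u
  simp only at h
  have h1 : a ≤ 1 := by nlinarith [mul_self_nonneg b]
  have h2 : -1 ≤ a := by nlinarith [mul_self_nonneg b]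
  have h3 : b ≤ 1 := by nlinarith
  have h4 : -1 ≤ b := by nlinarith
  interval_cases a <;> interval_cases b <;> simp at h <;> decide

theorem norm_nn (x : R) : 0 ≤ x.norm := GaussianInt.norm_nonneg x

theorem unit_norm (u v : R) (h : u * v = 1) : u.norm = 1 := by
  have := congrArg Zsqrtd.norm h
  rw [Zsqrtd.norm_mul, Zsqrtd.norm_one] at this
  exact Int.eq_one_of_mul_eq_one_right (norm_nn u) this

theorem base_unit (M : SL2 R) (h : M 1 0 = 0) : (M 0 0) * M 1 1 = 1 := by
  have := det_eq M
  rw [h] at this; simpa using this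

theorem base_cases (M : SL2 R) (h : M 1 0 = 0) :
    M 0 0 = 1 ∨ M 0 0 = -1 ∨ M 0 0 = I' ∨ M 0 0 = -I' :=
  unit_cases _ (unit_norm _ _ (base_unit M h))

theorem baseT (M : SL2 R) (h : M 1 0 = 0) (q : R) : sig B (TT q * M) = B.t q * sig B M := by
  rw [sig_base B M h, sig_base B _ (by rw [TT10, h]), TT00, TT01, h, ← mul_assoc, ← B.tadd]
  have : (M 0 1 + q * M 1 1) * (M 0 0 + q * 0) = q + M 0 1 * M 0 0 := by
    linear_combination q * base_unit M h
  rw [this]; simp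

theorem baseN (M : SL2 R) (h : M 1 0 = 0) : sig B (-M) = sig B M := by
  rw [sig_base B M h, sig_base B _ (by rw [neg_app, h, neg_zero]), neg_app, neg_app]
  simp

theorem baseL (M : SL2 R) (h : M 1 0 = 0) : sig B (LL * M) = B.L * sig B M := by
  rw [sig_base B M h, sig_base B _ (by rw [LL10, h]; simp), LL00, LL01]
  have : (I' * M 0 1) * (I' * M 0 0) = -(M 0 1 * M 0 0) := by
    linear_combination (M 0 1 * M 0 0) * I_sq
  rw [this, ← mul_assoc, B.Lt]
  rcases base_cases M h with h | h | h | h <;> rw [h] <;> simp [I', mul_assoc, B.L2]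

/-- independence at M -/
def Ind (M : SL2 R) : Prop := M 1 0 ≠ 0 → ∀ q : R, (M 0 0 - q * M 1 0).norm < (M 1 0).norm →
  sig B M = B.t q * B.S * sig B (SS * (TT (-q) * M))

theorem norm_neg' (x : R) : (-x).norm = x.norm := Zsqrtd.norm_neg x

theorem mod_lt (x y : R) (h : y ≠ 0) : (x - (x / y) * y).norm < y.norm := by
  have := norm_mod_lt x y h
  have := norm_nn (x - (x / y) * y)
  have := norm_nn y
  omega

theorem equivT (M : SL2 R) (p : R) (h1 : Ind B M) (h2 : Ind B (TT p * M)) :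
    sig B (TT p * M) = B.t p * sig B M := by
  by_cases h : M 1 0 = 0
  · exact baseT B M h p
  have hm := mod_lt (M 0 0) (M 1 0) h
  set q := M 0 0 / M 1 0
  rw [h1 h q hm, h2 (by rwa [TT10]) (q + p) (by
    rw [TT00, TT10]; convert hm using 2; ring)]
  rw [← mul_assoc (TT _), ← TT_add, add_comm q p, B.tadd]
  simp [mul_assoc]

theorem equivN (n : ℤ) (hI : ∀ M : SL2 R, (M 1 0).norm < n → Ind B M) (k : ℕ) :
    ∀ M : SL2 R, (M 1 0).norm < n → (M 1 0).norm < k → sig B (-M) = sig B M := by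
  induction k with
  | zero => intro M _ h; have := norm_nn (M 1 0); simp at h; omega
  | succ k ih =>
    intro M hn hk
    by_cases h : M 1 0 = 0
    · exact baseN B M h
    have hm := mod_lt (M 0 0) (M 1 0) h
    set q := M 0 0 / M 1 0
    rw [hI M hn h q hm, hI (-M) (by rwa [neg_app, norm_neg']) (by rwa [neg_app, neg_ne_zero]) q
      (by rw [neg_app, neg_app, norm_neg', ← norm_neg']; convert hm using 2; ring),
      mul_neg, mul_neg, ih]
    · rw [dec10]; omega
    · rw [dec10]; push_cast at hk; omega

theorem equivN' (n : ℤ) (hI : ∀ M : SL2 R, (M 1 0).norm < n → Ind B M)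
    (M : SL2 R) (h : (M 1 0).norm < n) : sig B (-M) = sig B M :=
  equivN B n hI ((M 1 0).norm.toNat + 1) M h (by have := norm_nn (M 1 0); omega)

theorem norm_I (x : R) : (I' * x).norm = x.norm := by
  rw [Zsqrtd.norm_mul]; simp [I', Zsqrtd.norm_def]

theorem equivL (n : ℤ) (hI : ∀ M : SL2 R, (M 1 0).norm < n → Ind B M) (k : ℕ) :
    ∀ M : SL2 R, (M 1 0).norm < n → (M 1 0).norm < k → sig B (LL * M) = B.L * sig B M := by
  induction k with
  | zero => intro M _ h; have := norm_nn (M 1 0); simp at h; omega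
  | succ k ih =>
    intro M hn hk
    by_cases h : M 1 0 = 0
    · exact baseL B M h
    have hm := mod_lt (M 0 0) (M 1 0) h
    set q := M 0 0 / M 1 0
    have hl : ((LL * M) 1 0).norm = (M 1 0).norm := by rw [LL10, norm_neg', norm_I]
    have e : SS * (TT (- -q) * (LL * M)) = -(LL * (SS * (TT (-q) * M))) := by
      rw [← mul_assoc (TT _), neg_neg, TTLL, mul_assoc, ← mul_assoc SS, SSLL]
      simp [mul_assoc]
    rw [hI M hn h q hm, hI (LL * M) (by rwa [hl])
      (by rw [LL10, neg_ne_zero]; exact mul_ne_zero (by decide) h) (-q)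
      (by rw [hl]; convert hm using 1; rw [LL00, LL10, ← norm_I (M 0 0 - _)]; congr 1; ring),
      e, equivN' B n hI, ih]
    · simp only [← mul_assoc, B.Lt]
      simp only [mul_assoc, ← B.SL]
    · rw [dec10]; omega
    · rw [dec10]; push_cast at hk; omega
    · rw [LL10, norm_neg', norm_I, dec10]; omega

theorem equivL' (n : ℤ) (hI : ∀ M : SL2 R, (M 1 0).norm < n → Ind B M)
    (M : SL2 R) (h : (M 1 0).norm < n) : sig B (LL * M) = B.L * sig B M :=
  equivL B n hI ((M 1 0).norm.toNat + 1) M h (by have := norm_nn (M 1 0); omega)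

theorem unit_rel (p : R) (hp : p.norm = 1) : ∃ (p' : R) (D : SL2 R) (g : G), p * p' = 1 ∧
    ((D = 1 ∧ g = 1) ∨ (D = LL ∧ g = B.L)) ∧
    (SS * TT (-p) = TT p' * (SS * (D * (TT p' * SS))) ∨
      SS * TT (-p) = -(TT p' * (SS * (D * (TT p' * SS))))) ∧
    B.S * B.t (-p) * B.S = B.t p' * B.S * g * B.t p' := by
  rcases unit_cases p hp with rfl | rfl | rfl | rfl
  · refine ⟨1, 1, 1, by decide, Or.inl ⟨rfl, rfl⟩, ?_, by simpa using B.r1n⟩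
    first
    | (left; apply sl_ext <;> decide)
    | (right; apply sl_ext <;> decide)
  · refine ⟨-1, 1, 1, by decide, Or.inl ⟨rfl, rfl⟩, ?_, by simpa using B.r1⟩
    first
    | (left; apply sl_ext <;> decide)
    | (right; apply sl_ext <;> decide)
  · refine ⟨-I', LL, B.L, by decide, Or.inr ⟨rfl, rfl⟩, ?_, by simpa using B.rin⟩
    first
    | (left; apply sl_ext <;> decide)
    | (right; apply sl_ext <;> decide)
  · refine ⟨I', LL, B.L, by decide, Or.inr ⟨rfl, rfl⟩, ?_, by simpa using B.ri⟩
    first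
    | (left; apply sl_ext <;> decide)
    | (right; apply sl_ext <;> decide)

theorem core (n : ℤ) (hI : ∀ M : SL2 R, (M 1 0).norm < n → Ind B M) (M : SL2 R) (p : R)
    (hp : p.norm = 1) (h1 : (M 0 0).norm < n) (h2 : (M 0 0 - p * M 1 0).norm < n)
    (hS : ∀ Q : SL2 R, (Q 1 0).norm = (M 0 0).norm → (Q 0 0).norm = (M 0 0 - p * M 1 0).norm →
      sig B (SS * Q) = B.S * sig B Q) :
    sig B (SS * (TT (-p) * M)) = B.S * B.t (-p) * B.S * sig B (SS * M) := by
  obtain ⟨p', D, g, hpp, hD, hm, hg⟩ := unit_rel B p hp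
  have a1 : sig B (TT p' * (SS * M)) = B.t p' * sig B (SS * M) :=
    equivT B _ _ (hI _ (by rwa [SS10])) (hI _ (by rwa [TT10, SS10]))
  have n1 : ((TT p' * (SS * M)) 1 0).norm = (M 0 0).norm := by rw [TT10, SS10]
  have n2 : ((TT p' * (SS * M)) 0 0).norm = (M 0 0 - p * M 1 0).norm := by
    have e : M 0 0 - p * M 1 0 = p * (- M 1 0 + p' * M 0 0) := by
      linear_combination (- M 0 0) * hpp
    rw [TT00, SS10, SS00, e, Zsqrtd.norm_mul p, hp, one_mul]
  have a2 : sig B (D * (TT p' * (SS * M))) = g * sig B (TT p' * (SS * M)) ∧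
      ((D * (TT p' * (SS * M))) 1 0).norm = (M 0 0).norm ∧
      ((D * (TT p' * (SS * M))) 0 0).norm = (M 0 0 - p * M 1 0).norm := by
    rcases hD with ⟨rfl, rfl⟩ | ⟨rfl, rfl⟩
    · rw [one_mul, one_mul]; exact ⟨rfl, n1, n2⟩
    · refine ⟨equivL' B n hI _ (by rwa [n1]), ?_, ?_⟩
      · rw [LL10, norm_neg', norm_I, n1]
      · rw [LL00, norm_I, n2]
  obtain ⟨a2, n3, n4⟩ := a2
  have a3 := hS _ n3 n4
  have n5 : ((SS * (D * (TT p' * (SS * M)))) 1 0).norm < n := by rw [SS10, n4]; exact h2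
  have a4 : sig B (TT p' * (SS * (D * (TT p' * (SS * M))))) =
      B.t p' * sig B (SS * (D * (TT p' * (SS * M)))) :=
    equivT B _ _ (hI _ n5) (hI _ (by rwa [TT10]))
  have fin : sig B (SS * (TT (-p) * M)) = sig B (TT p' * (SS * (D * (TT p' * (SS * M))))) := by
    rw [← mul_assoc SS]
    rcases hm with hm | hm
    · rw [hm]; simp only [mul_assoc]
    · rw [hm, neg_mul]; simp only [mul_assoc]
      apply equivN' B n hI
      rwa [TT10]
  rw [fin, a4, a3, a2, a1, hg]
  simp only [mul_assoc]

theorem equivS_ne (n : ℤ) (hI : ∀ M : SL2 R, (M 1 0).norm < n → Ind B M) (M : SL2 R)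
    (h1 : (M 0 0).norm < n) (h2 : (M 1 0).norm < n) (hne : (M 0 0).norm ≠ (M 1 0).norm) :
    sig B (SS * M) = B.S * sig B M := by
  rcases lt_or_gt_of_ne hne with h | h
  · have := hI M h2 (by intro h0; rw [h0] at h; have := norm_nn (M 0 0); simp at h; omega) 0
      (by simpa using h)
    rw [neg_zero, TT_zero, one_mul, B.t0, one_mul] at this
    rw [this, ← mul_assoc, B.S2, one_mul]
  · have := hI (SS * M) (by rwa [SS10])
      (by rw [SS10]; intro h0; rw [h0] at h; have := norm_nn (M 1 0); simp at h; omega) 0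
      (by rw [SS10, SS00]; simpa using h)
    rw [neg_zero, TT_zero, one_mul, B.t0, one_mul, ← mul_assoc, SS_sq, neg_mul, one_mul,
      equivN' B n hI _ h2] at this
    exact this

theorem exists_unit (x y : R) (h : x.norm = y.norm) (hy : 0 < y.norm) :
    ∃ p : R, p.norm = 1 ∧ (x - p * y).norm < y.norm := by
  by_contra! hc
  have c1 := hc 1 (by decide)
  have c2 := hc (-1) (by decide)
  have c3 := hc I' (by decide)
  have c4 := hc (-I') (by decide)
  obtain ⟨a, b⟩ := x
  obtain ⟨c, d⟩ := y
  simp only [Zsqrtd.norm_def, I', Zsqrtd.re_sub, Zsqrtd.im_sub, Zsqrtd.re_mul, Zsqrtd.im_mul,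
    Zsqrtd.re_neg, Zsqrtd.im_neg, Zsqrtd.re_one, Zsqrtd.im_one] at *
  set m := c * c - -1 * d * d with hm
  have e1 : 2 * (a * c + b * d) ≤ m := by nlinarith
  have e2 : -m ≤ 2 * (a * c + b * d) := by nlinarith
  have e3 : 2 * (b * c - a * d) ≤ m := by nlinarith
  have e4 : -m ≤ 2 * (b * c - a * d) := by nlinarith
  have e5 : (a * c + b * d) ^ 2 + (b * c - a * d) ^ 2 = m * m := by
    have : (a * c + b * d) ^ 2 + (b * c - a * d) ^ 2 = (a * a - -1 * b * b) * m := by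
      rw [hm]; ring
    rw [this, h]
  have e6 : (2 * (a * c + b * d)) ^ 2 ≤ m ^ 2 := sq_le_sq' e2 e1
  have e7 : (2 * (b * c - a * d)) ^ 2 ≤ m ^ 2 := sq_le_sq' e4 e3
  nlinarith

theorem equivS (n : ℤ) (hI : ∀ M : SL2 R, (M 1 0).norm < n → Ind B M) (M : SL2 R)
    (h1 : (M 0 0).norm < n) (h2 : (M 1 0).norm < n) :
    sig B (SS * M) = B.S * sig B M := by
  by_cases hne : (M 0 0).norm = (M 1 0).norm
  swap
  · exact equivS_ne B n hI M h1 h2 hne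
  have hy : 0 < (M 1 0).norm := by
    rcases (norm_nn (M 1 0)).lt_or_eq with h | h
    · exact h
    · exfalso
      rw [← h] at hne
      have z1 := (GaussianInt.norm_eq_zero).1 hne
      have z2 := (GaussianInt.norm_eq_zero).1 h.symm
      have := det_eq M
      rw [z1, z2] at this
      simp at this
  obtain ⟨p, hp, hlt⟩ := exists_unit _ _ hne hy
  have e0 : (TT (-p) * M) 0 0 = M 0 0 - p * M 1 0 := by rw [TT00]; ring
  have e1 : (TT (-p) * M) 1 0 = M 1 0 := TT10 _ _
  have e2 : (TT (-p) * M) 0 0 - (-p) * (TT (-p) * M) 1 0 = M 0 0 := by rw [e0, e1]; ring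
  have c := core B n hI (TT (-p) * M) (-p) (by rwa [norm_neg']) (by rw [e0]; omega)
    (by rw [e2]; exact h1) (by
      rw [e2, e0]
      intro Q k1 k2
      apply equivS_ne B n hI <;> omega)
  rw [← mul_assoc (TT (- -p)), ← TT_add, neg_neg, add_neg_cancel, TT_zero, one_mul,
    equivS_ne B n hI (TT (-p) * M) (by rw [e0]; omega) (by rwa [e1]) (by rw [e0, e1]; omega),
    equivT B M (-p) (hI _ h2) (hI _ (by rwa [e1])), B.tneg] at c
  rw [c]
  simp only [mul_assoc]
  rw [← mul_assoc B.S B.S, B.S2, one_mul, mul_inv_cancel_left]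

theorem step1 (M : SL2 R) (hI : ∀ Q : SL2 R, (Q 1 0).norm < (M 1 0).norm → Ind B Q) (q p : R)
    (hp : p.norm = 1) (h1 : (M 0 0 - q * M 1 0).norm < (M 1 0).norm)
    (h2 : (M 0 0 - (q + p) * M 1 0).norm < (M 1 0).norm) :
    B.t q * B.S * sig B (SS * (TT (-q) * M)) =
      B.t (q + p) * B.S * sig B (SS * (TT (-(q + p)) * M)) := by
  have e0 : (TT (-q) * M) 0 0 = M 0 0 - q * M 1 0 := by rw [TT00]; ring
  have e1 : (TT (-q) * M) 1 0 = M 1 0 := TT10 _ _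
  have e2 : (TT (-q) * M) 0 0 - p * (TT (-q) * M) 1 0 = M 0 0 - (q + p) * M 1 0 := by
    rw [e0, e1]; ring
  have c := core B _ hI (TT (-q) * M) p hp (by rwa [e0]) (by rwa [e2]) (by
    rw [e2, e0]
    intro Q k1 k2
    apply equivS B _ hI <;> omega)
  have : TT (-(q + p)) = TT (-p) * TT (-q) := by rw [← TT_add]; congr 1; ring
  rw [this, mul_assoc (TT _), c, B.tadd, B.tneg p]
  simp only [mul_assoc]
  rw [← mul_assoc B.S B.S, B.S2, one_mul, mul_inv_cancel_left]

theorem flag (r y : R) (s t : ℤ) :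
    (r - ⟨s, 0⟩ * y).norm + (r - ⟨0, t⟩ * y).norm = r.norm + (r - ⟨s, t⟩ * y).norm := by
  simp only [Zsqrtd.norm_def, Zsqrtd.re_sub, Zsqrtd.im_sub, Zsqrtd.re_mul, Zsqrtd.im_mul]
  ring

theorem small (r y p : R) (h1 : r.norm < y.norm) (h2 : (r - p * y).norm < y.norm) :
    p.norm < 4 := by
  have : (p * y).norm ≤ 2 * r.norm + 2 * (r - p * y).norm := by
    have e : (p * y).norm + (2 * r - p * y).norm = 2 * r.norm + 2 * (r - p * y).norm := by
      generalize p * y = z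
      have : (2 : R) * r = r + r := two_mul r
      rw [this]
      simp only [Zsqrtd.norm_def, Zsqrtd.re_sub, Zsqrtd.im_sub, Zsqrtd.re_add, Zsqrtd.im_add]
      ring
    have := norm_nn (2 * r - p * y)
    omega
  rw [Zsqrtd.norm_mul] at this
  have := norm_nn y
  by_contra! h
  have : 4 * y.norm ≤ p.norm * y.norm := mul_le_mul_of_nonneg_right h (norm_nn y)
  omega

theorem dist' (x q p y : R) : x - (q + p) * y = (x - q * y) - p * y := by ring

theorem step2 (M : SL2 R) (hI : ∀ Q : SL2 R, (Q 1 0).norm < (M 1 0).norm → Ind B Q)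
    (q p p1 p2 : R) (e : p = p1 + p2) (n1 : p1.norm = 1) (n2 : p2.norm = 1)
    (h1 : (M 0 0 - q * M 1 0).norm < (M 1 0).norm)
    (hk : (M 0 0 - (q + p1) * M 1 0).norm < (M 1 0).norm)
    (h2 : (M 0 0 - (q + p) * M 1 0).norm < (M 1 0).norm) :
    B.t q * B.S * sig B (SS * (TT (-q) * M)) =
      B.t (q + p) * B.S * sig B (SS * (TT (-(q + p)) * M)) := by
  subst e
  rw [← add_assoc] at h2 ⊢
  exact (step1 B M hI q p1 n1 h1 hk).trans (step1 B M hI (q + p1) p2 n2 hk h2)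

theorem stepAll (M : SL2 R) (hI : ∀ Q : SL2 R, (Q 1 0).norm < (M 1 0).norm → Ind B Q) (q p : R)
    (h1 : (M 0 0 - q * M 1 0).norm < (M 1 0).norm)
    (h2 : (M 0 0 - (q + p) * M 1 0).norm < (M 1 0).norm) :
    B.t q * B.S * sig B (SS * (TT (-q) * M)) =
      B.t (q + p) * B.S * sig B (SS * (TT (-(q + p)) * M)) := by
  have e : M 0 0 - (q + p) * M 1 0 = (M 0 0 - q * M 1 0) - p * M 1 0 := by ring
  have hs := small (M 0 0 - q * M 1 0) (M 1 0) p h1 (by rwa [← e])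
  obtain ⟨s, t⟩ := p
  have hf := flag (M 0 0 - q * M 1 0) (M 1 0) s t
  have e1 : (⟨s, t⟩ : R) = ⟨s, 0⟩ + ⟨0, t⟩ := by ext <;> simp
  have e2 : (⟨s, t⟩ : R) = ⟨0, t⟩ + ⟨s, 0⟩ := by ext <;> simp
  simp only [Zsqrtd.norm_def (⟨s, t⟩ : R)] at hs
  have b1 : s ≤ 1 := by nlinarith [mul_self_nonneg t]
  have b2 : -1 ≤ s := by nlinarith [mul_self_nonneg t]
  have b3 : t ≤ 1 := by nlinarith [mul_self_nonneg s]
  have b4 : -1 ≤ t := by nlinarith [mul_self_nonneg s]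
  by_cases hs0 : s = 0
  · by_cases ht0 : t = 0
    · subst hs0; subst ht0
      have : (⟨0, 0⟩ : R) = 0 := rfl
      rw [this, add_zero]
    · apply step1 B M hI q _ _ h1 h2
      have : t = 1 ∨ t = -1 := by omega
      subst hs0
      rcases this with rfl | rfl <;> decide
  · have hs1 : s = 1 ∨ s = -1 := by omega
    by_cases ht0 : t = 0
    · apply step1 B M hI q _ _ h1 h2
      subst ht0
      rcases hs1 with rfl | rfl <;> decide
    · have ht1 : t = 1 ∨ t = -1 := by omega
      have ns : (⟨s, 0⟩ : R).norm = 1 := by rcases hs1 with rfl | rfl <;> decide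
      have nt : (⟨0, t⟩ : R).norm = 1 := by rcases ht1 with rfl | rfl <;> decide
      rw [← e] at hf
      have d1 : M 0 0 - (q + ⟨s, 0⟩) * M 1 0 = (M 0 0 - q * M 1 0) - ⟨s, 0⟩ * M 1 0 := dist' _ _ _ _
      have d2 : M 0 0 - (q + ⟨0, t⟩) * M 1 0 = (M 0 0 - q * M 1 0) - ⟨0, t⟩ * M 1 0 := dist' _ _ _ _
      rw [← d1, ← d2] at hf
      by_cases hk : (M 0 0 - (q + ⟨s, 0⟩) * M 1 0).norm < (M 1 0).norm
      · exact step2 B M hI q _ _ _ e1 ns nt h1 hk h2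
      · have hk' : (M 0 0 - (q + ⟨0, t⟩) * M 1 0).norm < (M 1 0).norm := by omega
        exact step2 B M hI q _ _ _ e2 nt ns h1 hk' h2

theorem ind_all (k : ℕ) : ∀ M : SL2 R, (M 1 0).norm < k → Ind B M := by
  induction k with
  | zero => intro M h; have := norm_nn (M 1 0); simp at h; omega
  | succ k ih =>
    intro M hk h q hq
    rw [sig_step B M h]
    have hm := mod_lt (M 0 0) (M 1 0) h
    set q0 := M 0 0 / M 1 0
    have := stepAll B M (fun Q hQ => ih Q (by push_cast at hk; omega)) q0 (q - q0) hm
      (by rw [add_sub_cancel]; exact hq)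
    rw [add_sub_cancel] at this
    exact this

theorem ind' (M : SL2 R) : Ind B M :=
  ind_all B ((M 1 0).norm.toNat + 1) M (by have := norm_nn (M 1 0); omega)

theorem fT (q : R) (M : SL2 R) : sig B (TT q * M) = B.t q * sig B M :=
  equivT B M q (ind' B _) (ind' B _)
theorem fN (M : SL2 R) : sig B (-M) = sig B M :=
  equivN' B ((M 1 0).norm + 1) (fun Q _ => ind' B Q) M (by omega)
theorem fL (M : SL2 R) : sig B (LL * M) = B.L * sig B M :=
  equivL' B ((M 1 0).norm + 1) (fun Q _ => ind' B Q) M (by omega)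
theorem fS (M : SL2 R) : sig B (SS * M) = B.S * sig B M :=
  equivS B ((M 0 0).norm + (M 1 0).norm + 1) (fun Q _ => ind' B Q) M
    (by have := norm_nn (M 1 0); omega) (by have := norm_nn (M 0 0); omega)

theorem sig_one : sig B 1 = 1 := by
  rw [sig_base B 1 rfl, e100, e101]; simp [B.t0]

/-- Induction principle: SL2 is generated by the elementary matrices. -/
theorem gen_ind (P : SL2 R → Prop) (h1 : P 1) (hT : ∀ q M, P M → P (TT q * M))
    (hS : ∀ M, P M → P (SS * M)) (hL : ∀ M, P M → P (LL * M)) (M : SL2 R) : P M := by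
  have hN : ∀ M, P M → P (-M) := by
    intro M h
    have := hS _ (hS _ h)
    rwa [← mul_assoc, SS_sq, neg_mul, one_mul] at this
  have key : ∀ k : ℕ, ∀ M : SL2 R, (M 1 0).norm < k → P M := by
    intro k
    induction k with
    | zero => intro M h; have := norm_nn (M 1 0); simp at h; omega
    | succ k ih =>
      intro M hk
      by_cases h : M 1 0 = 0
      · have hu := base_unit M h
        have hd : ∀ D : SL2 R, P D → D 0 0 = M 0 0 → D 0 1 = 0 → D 1 0 = 0 → D 1 1 = M 1 1 →
            P M := by
          intro D hD d0 d1 d2 d3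
          have : M = TT (M 0 1 * M 0 0) * D := by
            apply sl_ext
            · rw [TT00, d0, d2]; ring
            · rw [TT01, d1, d3]; linear_combination (-M 0 1) * hu
            · rw [TT10, d2, h]
            · rw [TT11, d3]
          rw [this]
          exact hT _ _ hD
        have hLL : P LL := by simpa using hL 1 h1
        have hi := I_sq
        rcases base_cases M h with h0 | h0 | h0 | h0 <;> rw [h0] at hu
        · exact hd 1 h1 (by rw [h0]; rfl) rfl rfl (by rw [e111]; linear_combination -hu)
        · exact hd (-1) (hN _ h1) (by rw [h0]; rfl) (by rw [neg_app, e101, neg_zero])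
            (by rw [neg_app, e110, neg_zero]) (by rw [neg_app, e111]; linear_combination hu)
        · exact hd LL hLL (by rw [h0]; rfl) rfl rfl
            (by rw [eL11]; linear_combination (-M 1 1) * hi + I' * hu)
        · exact hd (-LL) (hN _ hLL) (by rw [h0]; rfl) (by rw [neg_app, eL01, neg_zero])
            (by rw [neg_app, eL10, neg_zero])
            (by rw [neg_app, eL11]; linear_combination (-M 1 1) * hi - I' * hu)
      · have hm := mod_lt (M 0 0) (M 1 0) h
        set q := M 0 0 / M 1 0
        have := hN _ (hS _ (ih (SS * (TT (-q) * M)) (by rw [dec10]; push_cast at hk; omega)))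
        rw [← mul_assoc SS, SS_sq, neg_mul, neg_neg, one_mul] at this
        have := hT q _ this
        rwa [← mul_assoc, ← TT_add, add_neg_cancel, TT_zero, one_mul] at this
  exact key ((M 1 0).norm.toNat + 1) M (by have := norm_nn (M 1 0); omega)

theorem sig_mul (M N : SL2 R) : sig B (M * N) = sig B M * sig B N := by
  induction M using gen_ind with
  | h1 => rw [one_mul, sig_one, one_mul]
  | hT q M ih => rw [mul_assoc, fT, fT, ih, mul_assoc]
  | hS M ih => rw [mul_assoc, fS, fS, ih, mul_assoc]
  | hL M ih => rw [mul_assoc, fL, fL, ih, mul_assoc]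

noncomputable def sigHom : SL2 R →* G where
  toFun := sig B
  map_one' := sig_one B
  map_mul' := sig_mul B

theorem neg_one_central : (-1 : SL2 R) ∈ Subgroup.center (SL2 R) := by
  rw [Subgroup.mem_center_iff]; intro g; simp

theorem center_cases (M : SL2 R) (h : M ∈ Subgroup.center (SL2 R)) : M = 1 ∨ M = -1 := by
  rw [Subgroup.mem_center_iff] at h
  have a := congrArg (fun Q : SL2 R => Q 0 0) (h (TT 1))
  have b := congrArg (fun Q : SL2 R => Q 0 1) (h (TT 1))
  have c := congrArg (fun Q : SL2 R => Q 0 1) (h SS)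
  simp only [mul_ap, eT00, eT01, eT10, eT11, eS00, eS01, eS10, eS11] at a b c
  have z : M 1 0 = 0 := by linear_combination a
  have y : M 1 1 = M 0 0 := by linear_combination b
  have x : M 0 1 = 0 := by
    have d := congrArg (fun Q : SL2 R => Q 0 0) (h SS)
    simp only [mul_ap, eS00, eS01, eS10, eS11] at d
    rw [z] at d
    linear_combination -d
  have u := base_unit M z
  rw [y] at u
  have : (M 0 0 - 1) * (M 0 0 + 1) = 0 := by linear_combination u
  rcases mul_eq_zero.1 this with h' | h'
  · left
    have h' : M 0 0 = 1 := by linear_combination h'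
    apply sl_ext
    · rw [h', e100]
    · rw [x, e101]
    · rw [z, e110]
    · rw [y, h', e111]
  · right
    have h' : M 0 0 = -1 := by linear_combination h'
    apply sl_ext <;> rw [neg_app]
    · rw [h', e100]
    · rw [x, e101, neg_zero]
    · rw [z, e110, neg_zero]
    · rw [y, h', e111]

noncomputable def psi : PSL2 R →* G :=
  QuotientGroup.lift _ (sigHom B) (by
    intro M hM
    rcases center_cases M hM with rfl | rfl
    · exact sig_one B
    · exact (fN B 1).trans (sig_one B))

theorem psi_mk (M : SL2 R) : psi B (QuotientGroup.mk M) = sig B M := rfl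

theorem mk_neg (M : SL2 R) : (QuotientGroup.mk (-M) : PSL2 R) = QuotientGroup.mk M := by
  rw [QuotientGroup.eq]
  have : (-M)⁻¹ * M = -1 := by
    rw [inv_mul_eq_iff_eq_mul]; simp
  rw [this]
  exact neg_one_central

theorem phi_psi (phi : G →* PSL2 R) (hS : phi B.S = QuotientGroup.mk SS)
    (hL : phi B.L = QuotientGroup.mk LL) (ht : ∀ q, phi (B.t q) = QuotientGroup.mk (TT q))
    (x : PSL2 R) : phi (psi B x) = x := by
  induction x using QuotientGroup.induction_on with
  | H M =>
    rw [psi_mk]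
    induction M using gen_ind with
    | h1 => rw [sig_one, map_one]; rfl
    | hT q M ih => rw [fT, map_mul, ih, ht]; rfl
    | hS M ih => rw [fS, map_mul, ih, hS]; rfl
    | hL M ih => rw [fL, map_mul, ih, hL]; rfl

end Bianchi

namespace Bianchi

theorem mk_one_of (M : SL2 R) (h : M = 1 ∨ M = -1) : (QuotientGroup.mk M : PSL2 R) = 1 := by
  rcases h with rfl | rfl
  · rfl
  · rw [mk_neg]; rfl

noncomputable def mkBD {G : Type*} [Group G] (a b c d : G) (ha : a ^ 3 = 1) (hb : b ^ 2 = 1)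
    (hc : c ^ 3 = 1) (hd : d ^ 2 = 1) (hac : (a * c) ^ 2 = 1) (had : (a * d) ^ 2 = 1)
    (hbc : (b * c) ^ 2 = 1) (hbd : (b * d) ^ 2 = 1) : BD G :=
  have bb : b * b = 1 := by rw [← sq, hb]
  have dd : d * d = 1 := by rw [← sq, hd]
  have bi : b⁻¹ = b := by rw [inv_eq_iff_mul_eq_one, bb]
  have di : d⁻¹ = d := by rw [inv_eq_iff_mul_eq_one, dd]
  have db : d * b = b * d := by
    have : b * d = (b * d)⁻¹ := by rw [eq_inv_iff_mul_eq_one, ← sq, hbd]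
    rw [this, mul_inv_rev, bi, di]
  have da : d * a = a⁻¹ * d := by
    have : a * d = (a * d)⁻¹ := by rw [eq_inv_iff_mul_eq_one, ← sq, had]
    rw [mul_inv_rev, di] at this
    rw [eq_inv_mul_iff_mul_eq, ← mul_assoc, this, mul_assoc]; simp
  have bc : b * c = c⁻¹ * b := by
    have : b * c = (b * c)⁻¹ := by rw [eq_inv_iff_mul_eq_one, ← sq, hbc]
    rw [this, mul_inv_rev, bi]
  have cb : c * b = b * c⁻¹ := by
    rw [eq_mul_inv_iff_mul_eq, mul_assoc, bc, mul_inv_cancel_left]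
  have ac : a * c = c⁻¹ * a⁻¹ := by
    have : a * c = (a * c)⁻¹ := by rw [eq_inv_iff_mul_eq_one, ← sq, hac]
    rw [this, mul_inv_rev]
  have aa : a⁻¹ * a⁻¹ = a := by
    have : a * a * a = 1 := by rw [← ha, pow_succ, sq]
    rw [← mul_inv_rev, inv_eq_iff_mul_eq_one, this]
  have cc : c * c = c⁻¹ := by
    have : c * c * c = 1 := by rw [← hc, pow_succ, sq]
    rw [eq_inv_iff_mul_eq_one, this]
  have comm : Commute (b * a) (c * d) := by
    change b * a * (c * d) = c * d * (b * a)
    calc b * a * (c * d) = b * (a * c) * d := by group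
      _ = b * c⁻¹ * (a⁻¹ * d) := by rw [ac]; group
      _ = c * (b * d) * a := by rw [← cb, ← da]; group
      _ = c * d * (b * a) := by rw [← db]; group
  have s1 : SemiconjBy (b * d) (b * a) (b * a)⁻¹ := by
    change b * d * (b * a) = (b * a)⁻¹ * (b * d)
    calc b * d * (b * a) = b * (d * b) * a := by group
      _ = (b * b) * (d * a) := by rw [db]; group
      _ = (b * a)⁻¹ * (b * d) := by rw [bb, da]; group
  have s2 : SemiconjBy (b * d) (c * d) (c * d)⁻¹ := by
    change b * d * (c * d) = (c * d)⁻¹ * (b * d)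
    calc b * d * (c * d) = d * (b * c) * d := by rw [← db]; group
      _ = (c * d)⁻¹ * (b * d) := by rw [bc, mul_inv_rev, di]; group
  { S := b
    L := b * d
    t := fun q => (b * a) ^ q.re * (c * d) ^ q.im
    S2 := bb
    L2 := by rw [← sq, hbd]
    SL := by rw [mul_assoc, db]
    tadd := by
      intro p q
      simp only [Zsqrtd.re_add, Zsqrtd.im_add, zpow_add]
      have := (comm.zpow_zpow q.re p.im).eq
      simp only [mul_assoc]
      rw [← mul_assoc ((b * a) ^ q.re), this]
      simp only [mul_assoc]
    Lt := by
      intro q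
      have := ((s1.zpow_right q.re).mul_right (s2.zpow_right q.im)).eq
      simp only [inv_zpow'] at this
      simpa only [Zsqrtd.re_neg, Zsqrtd.im_neg] using this
    r1 := by
      simp only [Zsqrtd.re_one, Zsqrtd.im_one, Zsqrtd.re_neg, Zsqrtd.im_neg, neg_zero, zpow_zero,
        mul_one, zpow_one, zpow_neg]
      calc b * (b * a) * b = (b * b) * a * b := by group
        _ = a⁻¹ * a⁻¹ * b := by rw [bb, aa, one_mul]
        _ = (b * a)⁻¹ * b * (b * a)⁻¹ := by rw [mul_inv_rev, bi, mul_assoc a⁻¹ b b, bb]; group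
    ri := by
      simp only [I', zpow_zero, one_mul, zpow_one]
      calc b * (c * d) * b = (b * c) * (d * b) := by group
        _ = c⁻¹ * (b * b) * d := by rw [bc, db]; group
        _ = c⁻¹ * d := by rw [bb, mul_one]
        _ = c * (d * d) * c * d := by rw [dd, mul_one, cc]
        _ = c * d * (b * b) * d * c * d := by rw [bb]; group
        _ = c * d * b * (b * d) * (c * d) := by group }

def TTh : Multiplicative R →* SL2 R where
  toFun q := TT q.toAdd
  map_one' := TT_zero
  map_mul' p q := TT_add _ _

theorem TT_dec (q : R) : TT q = TT 1 ^ q.re * TT I' ^ q.im := by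
  have h1 : TT 1 ^ q.re = TT (q.re • (1 : R)) :=
    (map_zpow TTh (Multiplicative.ofAdd (1 : R)) q.re).symm
  have h2 : TT I' ^ q.im = TT (q.im • I') :=
    (map_zpow TTh (Multiplicative.ofAdd I') q.im).symm
  rw [h1, h2, ← TT_add]
  congr 1
  ext <;> simp [I']

def im : Fin 4 → PSL2 R
  | 0 => QuotientGroup.mk (SS * TT 1)
  | 1 => QuotientGroup.mk SS
  | 2 => QuotientGroup.mk (TT I' * (SS * LL))
  | 3 => QuotientGroup.mk (SS * LL)

abbrev rels : Set (FreeGroup (Fin 4)) := {FreeGroup.of 0 ^ 3, FreeGroup.of 1 ^ 2, FreeGroup.of 2 ^ 3,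
        FreeGroup.of 3 ^ 2, (FreeGroup.of 0 * FreeGroup.of 2) ^ 2,
        (FreeGroup.of 0 * FreeGroup.of 3) ^ 2, (FreeGroup.of 1 * FreeGroup.of 2) ^ 2,
        (FreeGroup.of 1 * FreeGroup.of 3) ^ 2}

theorem im_rels : ∀ r ∈ rels, FreeGroup.lift im r = 1 := by
  have e2 : ∀ M : SL2 R, M * M = 1 ∨ M * M = -1 → (QuotientGroup.mk M : PSL2 R) ^ 2 = 1 := by
    intro M h
    rw [sq]
    exact mk_one_of _ h
  have e3 : ∀ M : SL2 R, M * M * M = 1 ∨ M * M * M = -1 →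
      (QuotientGroup.mk M : PSL2 R) ^ 3 = 1 := by
    intro M h
    rw [pow_succ, sq]
    exact mk_one_of _ h
  intro r hr
  simp only [rels, Set.mem_insert_iff, Set.mem_singleton_iff] at hr
  rcases hr with rfl | rfl | rfl | rfl | rfl | rfl | rfl | rfl <;>
    simp only [map_pow, map_mul, FreeGroup.lift_apply_of]
  · apply e3
    first
    | (left; apply sl_ext <;> decide)
    | (right; apply sl_ext <;> decide)
  · apply e2
    first
    | (left; apply sl_ext <;> decide)
    | (right; apply sl_ext <;> decide)
  · apply e3
    first
    | (left; apply sl_ext <;> decide)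
    | (right; apply sl_ext <;> decide)
  · apply e2
    first
    | (left; apply sl_ext <;> decide)
    | (right; apply sl_ext <;> decide)
  · apply e2 ((SS * TT 1) * (TT I' * (SS * LL)))
    first
    | (left; apply sl_ext <;> decide)
    | (right; apply sl_ext <;> decide)
  · apply e2 ((SS * TT 1) * (SS * LL))
    first
    | (left; apply sl_ext <;> decide)
    | (right; apply sl_ext <;> decide)
  · apply e2 (SS * (TT I' * (SS * LL)))
    first
    | (left; apply sl_ext <;> decide)
    | (right; apply sl_ext <;> decide)
  · apply e2 (SS * (SS * LL))
    first
    | (left; apply sl_ext <;> decide)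
    | (right; apply sl_ext <;> decide)

abbrev PG := PresentedGroup rels

def phi : PG →* PSL2 R := PresentedGroup.toGroup im_rels

theorem phi_of (i : Fin 4) : phi (PresentedGroup.of i) = im i := PresentedGroup.toGroup.of im_rels

theorem rel_one (r : FreeGroup (Fin 4)) (h : r ∈ rels) : PresentedGroup.mk rels r = 1 :=
  PresentedGroup.one_of_mem h

noncomputable def theBD : BD PG :=
  mkBD (PresentedGroup.of 0) (PresentedGroup.of 1) (PresentedGroup.of 2) (PresentedGroup.of 3)
    (rel_one (FreeGroup.of 0 ^ 3) (by simp [rels]))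
    (rel_one (FreeGroup.of 1 ^ 2) (by simp [rels]))
    (rel_one (FreeGroup.of 2 ^ 3) (by simp [rels]))
    (rel_one (FreeGroup.of 3 ^ 2) (by simp [rels]))
    (rel_one ((FreeGroup.of 0 * FreeGroup.of 2) ^ 2) (by simp [rels]))
    (rel_one ((FreeGroup.of 0 * FreeGroup.of 3) ^ 2) (by simp [rels]))
    (rel_one ((FreeGroup.of 1 * FreeGroup.of 2) ^ 2) (by simp [rels]))
    (rel_one ((FreeGroup.of 1 * FreeGroup.of 3) ^ 2) (by simp [rels]))

theorem bS : theBD.S = PresentedGroup.of 1 := rfl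
theorem bL : theBD.L = PresentedGroup.of 1 * PresentedGroup.of 3 := rfl
theorem bt (q : R) : theBD.t q = (PresentedGroup.of 1 * PresentedGroup.of 0) ^ q.re *
  (PresentedGroup.of 2 * PresentedGroup.of 3) ^ q.im := rfl

theorem im_L : im 1 * im 3 = QuotientGroup.mk LL := by
  change (QuotientGroup.mk (SS * (SS * LL)) : PSL2 R) = _
  rw [← mk_neg LL, ← mul_assoc, SS_sq, neg_mul, one_mul]

theorem im_T : im 1 * im 0 = QuotientGroup.mk (TT 1) := by
  change (QuotientGroup.mk (SS * (SS * TT 1)) : PSL2 R) = _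
  rw [← mk_neg (TT 1), ← mul_assoc, SS_sq, neg_mul, one_mul]

theorem im_U : im 2 * im 3 = QuotientGroup.mk (TT I') := by
  change (QuotientGroup.mk (TT I' * (SS * LL) * (SS * LL)) : PSL2 R) = _
  rcases (by
    first
    | (left; apply sl_ext <;> decide)
    | (right; apply sl_ext <;> decide) : TT I' * (SS * LL) * (SS * LL) = TT I' ∨
      TT I' * (SS * LL) * (SS * LL) = - TT I') with h | h
  · rw [h]
  · rw [h, mk_neg]

theorem phi_psi' (x : PSL2 R) : phi (psi theBD x) = x := by
  apply phi_psi
  · rw [bS, phi_of]; rfl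
  · rw [bL, map_mul, phi_of, phi_of, im_L]
  · intro q
    rw [bt, map_mul, map_zpow, map_zpow, map_mul, map_mul, phi_of, phi_of, phi_of, phi_of, im_T,
      im_U, TT_dec q]
    rfl

theorem psi_phi : (psi theBD).comp phi = MonoidHom.id PG := by
  have hb : (PresentedGroup.of 1 : PG) * PresentedGroup.of 1 = 1 := theBD.S2
  have hs : sig theBD SS = PresentedGroup.of 1 := by
    have := fS theBD 1
    rwa [mul_one, sig_one, mul_one] at this
  have hl : sig theBD LL = PresentedGroup.of 1 * PresentedGroup.of 3 := by
    have := fL theBD 1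
    rwa [mul_one, sig_one, mul_one] at this
  have ht : ∀ q, sig theBD (TT q) = theBD.t q := by
    intro q
    have := fT theBD q 1
    rwa [mul_one, sig_one, mul_one] at this
  have hd : (PresentedGroup.of 3 : PG) * PresentedGroup.of 3 = 1 := by
    rw [← sq]; exact rel_one (FreeGroup.of 3 ^ 2) (by simp [rels])
  apply PresentedGroup.ext
  intro i
  rw [MonoidHom.comp_apply, phi_of, MonoidHom.id_apply]
  fin_cases i
  · change sig theBD (SS * TT 1) = PresentedGroup.of 0
    rw [sig_mul, hs, ht, bt]
    simp only [Zsqrtd.re_one, Zsqrtd.im_one, zpow_zero, zpow_one, mul_one]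
    rw [← mul_assoc, hb, one_mul]
  · exact hs
  · change sig theBD (TT I' * (SS * LL)) = PresentedGroup.of 2
    rw [sig_mul, sig_mul, hs, hl, ht, bt, ← mul_assoc (PresentedGroup.of 1), hb]
    simp only [I', zpow_zero, zpow_one, one_mul]
    rw [mul_assoc, hd, mul_one]
  · change sig theBD (SS * LL) = PresentedGroup.of 3
    rw [sig_mul, hs, hl, ← mul_assoc, hb, one_mul]

end Bianchi

/-- The Bianchi group `PSL₂(ℤ[i])` admits the presentation
⟨a, b, c, d | a³ = b² = c³ = d² = (ac)² = (ad)² = (bc)² = (bd)² = 1⟩,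
where the generators `a, b, c, d` are indexed by `0, 1, 2, 3 : Fin 4`. -/
theorem bianchi_gaussian_presentation :
    Nonempty (PSL2 GaussianInt ≃*
      PresentedGroup ({FreeGroup.of 0 ^ 3, FreeGroup.of 1 ^ 2, FreeGroup.of 2 ^ 3,
        FreeGroup.of 3 ^ 2, (FreeGroup.of 0 * FreeGroup.of 2) ^ 2,
        (FreeGroup.of 0 * FreeGroup.of 3) ^ 2, (FreeGroup.of 1 * FreeGroup.of 2) ^ 2,
        (FreeGroup.of 1 * FreeGroup.of 3) ^ 2} : Set (FreeGroup (Fin 4)))) := by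
  exact ⟨MonoidHom.toMulEquiv (Bianchi.psi Bianchi.theBD) Bianchi.phi
    (MonoidHom.ext Bianchi.phi_psi') Bianchi.psi_phi⟩
end

section
/- The Bianchi group PSL₂(ℤ[i]) is generated by two elements; that is, there exist elements a, b ∈ PSL₂(ℤ[i]) such that the subgroup generated by {a, b} is all of PSL₂(ℤ[i]). -/
namespace BianchiAux

def E (z : GaussianInt) : SL2 GaussianInt := ⟨!![1, z; 0, 1], by simp [Matrix.det_fin_two]⟩

def S : SL2 GaussianInt := ⟨!![0, -1; 1, 0], by simp [Matrix.det_fin_two]⟩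

def A : SL2 GaussianInt :=
  ⟨!![0, 1; -1, ⟨-1, -1⟩], by simp [Matrix.det_fin_two]⟩

lemma E_coe (z : GaussianInt) :
    (E z : Matrix (Fin 2) (Fin 2) GaussianInt) = !![1, z; 0, 1] := rfl

lemma S_coe : (S : Matrix (Fin 2) (Fin 2) GaussianInt) = !![0, -1; 1, 0] := rfl

lemma S_inv_coe : ((S⁻¹ : SL2 GaussianInt) : Matrix (Fin 2) (Fin 2) GaussianInt)
    = !![0, 1; -1, 0] := by
  rw [Matrix.SpecialLinearGroup.coe_inv, S_coe, Matrix.adjugate_fin_two]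
  simp

lemma E_add (z w : GaussianInt) : E (z + w) = E z * E w := by
  apply Subtype.ext
  rw [Matrix.SpecialLinearGroup.coe_mul, E_coe, E_coe, E_coe, Matrix.mul_fin_two]
  simp [add_comm]

lemma E_zero : E 0 = 1 := by
  apply Subtype.ext
  rw [E_coe, Matrix.SpecialLinearGroup.coe_one, Matrix.one_fin_two]

lemma E_neg (z : GaussianInt) : E (-z) = (E z)⁻¹ := by
  rw [eq_inv_iff_mul_eq_one, ← E_add]
  simp [E_zero]

def K (H : Subgroup (SL2 GaussianInt)) : AddSubgroup GaussianInt where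
  carrier := {z | E z ∈ H}
  add_mem' := by
    intro a b ha hb
    simp only [Set.mem_ofPred_eq] at *
    rw [E_add]; exact H.mul_mem ha hb
  zero_mem' := by
    simp only [Set.mem_ofPred_eq]
    rw [E_zero]; exact H.one_mem
  neg_mem' := by
    intro a ha
    simp only [Set.mem_ofPred_eq] at *
    rw [E_neg]; exact H.inv_mem ha

lemma E_mem (H : Subgroup (SL2 GaussianInt)) (hT : E 1 ∈ H) (hU : E ⟨0, 1⟩ ∈ H)
    (z : GaussianInt) : E z ∈ H := by
  have h1 : (1 : GaussianInt) ∈ K H := hT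
  have h2 : (⟨0, 1⟩ : GaussianInt) ∈ K H := hU
  have h3 := (K H).add_mem ((K H).zsmul_mem h1 z.re) ((K H).zsmul_mem h2 z.im)
  have h4 : z.re • (1 : GaussianInt) + z.im • (⟨0, 1⟩ : GaussianInt) = z := by
    ext <;> simp
  rw [h4] at h3
  exact h3

lemma gen (H : Subgroup (SL2 GaussianInt)) (hS : S ∈ H) (hE : ∀ z, E z ∈ H) :
    ∀ n : ℕ, ∀ g : SL2 GaussianInt, (Zsqrtd.norm (g 1 0)).natAbs = n → g ∈ H := by
  intro n
  induction n using Nat.strong_induction_on with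
  | _ n ih =>
    intro g hg
    have hdet : g 0 0 * g 1 1 - g 0 1 * g 1 0 = 1 := by
      rw [← Matrix.det_fin_two]; exact g.2
    by_cases hc : g 1 0 = 0
    · rw [hc] at hdet
      have had : g 0 0 * g 1 1 = 1 := by simpa using hdet
      have hL : ∀ z, S * E (-z) * S⁻¹ ∈ H := fun z =>
        H.mul_mem (H.mul_mem hS (hE _)) (H.inv_mem hS)
      have key : g = E (g 0 0) * (S * E (- -(g 1 1)) * S⁻¹) * E (g 0 0) * S
          * E (g 1 1 * g 0 1) := by
        apply Subtype.ext
        simp only [Matrix.SpecialLinearGroup.coe_mul, E_coe, S_coe, S_inv_coe,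
          Matrix.mul_fin_two]
        rw [Matrix.eta_fin_two (g : Matrix (Fin 2) (Fin 2) GaussianInt), hc]
        generalize (g : Matrix (Fin 2) (Fin 2) GaussianInt) 0 0 = a at had ⊢
        generalize (g : Matrix (Fin 2) (Fin 2) GaussianInt) 1 1 = d at had ⊢
        generalize (g : Matrix (Fin 2) (Fin 2) GaussianInt) 0 1 = b
        congr 1
        clear ih hL hE
        ext i j : 2
        fin_cases i <;> fin_cases j <;> simp
        all_goals grind
      rw [key]
      exact H.mul_mem (H.mul_mem (H.mul_mem (H.mul_mem (hE _) (hL _)) (hE _)) hS) (hE _)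
    · have hlt := GaussianInt.natAbs_norm_mod_lt (g 0 0) hc
      have hent : (S * E (-(g 0 0 / g 1 0)) * g) 1 0 = g 0 0 % g 1 0 := by
        have := EuclideanDomain.div_add_mod (g 0 0) (g 1 0)
        simp only [Matrix.SpecialLinearGroup.coe_mul, E_coe, S_coe, Matrix.mul_fin_two]
        rw [Matrix.mul_apply, Fin.sum_univ_two]
        simp
        linear_combination -this
      have := ih _ (hg ▸ hlt) (S * E (-(g 0 0 / g 1 0)) * g) (by rw [hent])
      exact (H.mul_mem_cancel_left (H.mul_mem hS (hE _))).1 this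

end BianchiAux

open BianchiAux

/-- The Bianchi group `PSL₂(ℤ[i])` is generated by two elements. -/
theorem bianchi_gaussian_two_generators :
    ∃ a b : PSL2 GaussianInt, Subgroup.closure {a, b} = ⊤ := by
  refine ⟨QuotientGroup.mk A, QuotientGroup.mk (E 1), ?_⟩
  set C : Subgroup (PSL2 GaussianInt) :=
    Subgroup.closure {QuotientGroup.mk A, QuotientGroup.mk (E 1)} with hC
  let H : Subgroup (SL2 GaussianInt) := C.comap (QuotientGroup.mk' _)
  have hA : A ∈ H := Subgroup.subset_closure (by simp)
  have hT : E 1 ∈ H := Subgroup.subset_closure (by simp)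
  have hneg : (-1 : SL2 GaussianInt) ∈ H := by
    have h : (-1 : SL2 GaussianInt) ∈ Subgroup.center (SL2 GaussianInt) := by
      rw [Subgroup.mem_center_iff]; intro g; simp
    change QuotientGroup.mk (-1 : SL2 GaussianInt) ∈ C
    rw [(QuotientGroup.eq_one_iff _).2 h]
    exact C.one_mem
  have hneg' : ∀ g : SL2 GaussianInt, -g ∈ H → g ∈ H := by
    intro g hg
    have := H.mul_mem hneg hg
    simpa using this
  have hS' : E 1 * A * E 1 * A⁻¹ * E 1 ∈ H :=
    H.mul_mem (H.mul_mem (H.mul_mem (H.mul_mem hT hA) hT) (H.inv_mem hA)) hT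
  have hU' : A * E 1 * A⁻¹ * E 1 * A ∈ H :=
    H.mul_mem (H.mul_mem (H.mul_mem (H.mul_mem hA hT) (H.inv_mem hA)) hT) hA
  have hS : S ∈ H := by
    have e : E 1 * A * E 1 * A⁻¹ * E 1 = S ∨ E 1 * A * E 1 * A⁻¹ * E 1 = -S := by decide
    rcases e with e | e <;> rw [e] at hS'
    · exact hS'
    · exact hneg' _ hS'
  have hU : E ⟨0, 1⟩ ∈ H := by
    have e : A * E 1 * A⁻¹ * E 1 * A = E ⟨0, 1⟩ ∨ A * E 1 * A⁻¹ * E 1 * A = -E ⟨0, 1⟩ := by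
      decide
    rcases e with e | e <;> rw [e] at hU'
    · exact hU'
    · exact hneg' _ hU'
  rw [eq_top_iff]
  rintro x -
  induction x using QuotientGroup.induction_on with
  | H g => exact gen H hS (E_mem H hT hU) _ g rfl
end

section
/- The modular group PSL₂(ℤ) is isomorphic to the free product C₂ ∗ C₃ of a cyclic group of order 2 and a cyclic group of order 3. -/
namespace PSLAux

open Matrix

/-- Powers of an element of finite order as a homomorphism. -/
def zhom {G : Type*} [Group G] (n : ℕ) [NeZero n] (g : G) (hg : g ^ n = 1) :
    Multiplicative (ZMod n) →* G where
  toFun x := g ^ (Multiplicative.toAdd x).val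
  map_one' := by simp
  map_mul' x y := by
    rw [toAdd_mul, ZMod.val_add, ← pow_eq_pow_mod _ hg, pow_add]

/-- The order three element. -/
def U : SL2 ℤ := ⟨!![0, 1; -1, 1], by simp [Matrix.det_fin_two]⟩

/-- Quotient map. -/
abbrev q : SL2 ℤ →* PSL2 ℤ := QuotientGroup.mk' _

lemma q_neg_one : q (-1) = 1 := by
  rw [QuotientGroup.mk'_apply, QuotientGroup.eq_one_iff, Subgroup.mem_center_iff]
  intro g
  simp

lemma S2 : (q ModularGroup.S) ^ 2 = 1 := by
  rw [← map_pow, ← q_neg_one]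
  congr 1
  decide

lemma U3 : (q U) ^ 3 = 1 := by
  rw [← map_pow, ← q_neg_one]
  congr 1
  decide

/-- Product of the entries of the first column. -/
def ac : PSL2 ℤ → ℤ := Quotient.lift (fun g : SL2 ℤ => g 0 0 * g 1 0) (by
  intro a b h
  have h' : a⁻¹ * b ∈ Subgroup.center (SL2 ℤ) := QuotientGroup.leftRel_apply.mp h
  obtain ⟨r, hr, hc⟩ := Matrix.SpecialLinearGroup.mem_center_iff.mp h'
  have hb : b = a * (a⁻¹ * b) := by group
  have hr' : r * r = 1 := by simpa [pow_two] using hr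
  have e : ∀ i, b i 0 = a i 0 * r := by
    intro i
    have h2 : (b : Matrix (Fin 2) (Fin 2) ℤ) = a * (Matrix.scalar (Fin 2)) r := by
      rw [hc, ← Matrix.SpecialLinearGroup.coe_mul, ← hb]
    have h3 := congrFun (congrFun h2 i) 0
    rw [Matrix.mul_apply, Fin.sum_univ_two] at h3
    have e0 : Matrix.scalar (Fin 2) r 0 0 = r := by
      rw [Matrix.scalar_apply, Matrix.diagonal_apply_eq]
    have e1 : Matrix.scalar (Fin 2) r 1 0 = 0 := by
      rw [Matrix.scalar_apply, Matrix.diagonal_apply_ne _ (by decide)]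
    rw [h3, e0, e1, mul_zero, add_zero]
  simp only [e]
  linear_combination (-(a 0 0 * a 1 0)) * hr')

lemma ac_q (g : SL2 ℤ) : ac (q g) = g 0 0 * g 1 0 := rfl

/-- The factors. -/
abbrev ord (b : Bool) : ℕ := cond b 2 3
instance (b : Bool) : NeZero (ord b) := by cases b <;> exact ⟨by decide⟩
/-- The factors. -/
abbrev H (b : Bool) : Type := Multiplicative (ZMod (ord b))

/-- The generators. -/
def gen (b : Bool) : PSL2 ℤ := cond b (q ModularGroup.S) (q U)
lemma gen_pow (b : Bool) : gen b ^ (ord b) = 1 := by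
  cases b
  · exact U3
  · exact S2

/-- The maps. -/
def F (b : Bool) : H b →* PSL2 ℤ := zhom (ord b) (gen b) (gen_pow b)

/-- Ping-pong sets. -/
def X (b : Bool) : Set (PSL2 ℤ) := cond b {x | ac x < 0} {x | 0 < ac x}

lemma mul_col (A g : SL2 ℤ) (i : Fin 2) :
    (A * g) i 0 = A i 0 * g 0 0 + A i 1 * g 1 0 := by
  rw [Matrix.SpecialLinearGroup.coe_mul, Matrix.mul_apply, Fin.sum_univ_two]

lemma acS (x : PSL2 ℤ) (h : 0 < ac x) : ac (q ModularGroup.S * x) < 0 := by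
  obtain ⟨g, rfl⟩ := QuotientGroup.mk'_surjective _ x
  rw [← map_mul]
  rw [ac_q] at *
  rw [mul_col, mul_col, show (ModularGroup.S) 0 0 = 0 by decide, show (ModularGroup.S) 0 1 = -1 by decide, show (ModularGroup.S) 1 0 = 1 by decide, show (ModularGroup.S) 1 1 = 0 by decide]
  linarith

lemma acU (x : PSL2 ℤ) (h : ac x < 0) : 0 < ac (q U * x) := by
  obtain ⟨g, rfl⟩ := QuotientGroup.mk'_surjective _ x
  rw [← map_mul]
  rw [ac_q] at *
  rw [mul_col, mul_col, show (U) 0 0 = 0 by decide, show (U) 0 1 = 1 by decide, show (U) 1 0 = -1 by decide, show (U) 1 1 = 1 by decide]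
  nlinarith [sq_nonneg (g 1 0)]

lemma acUU (x : PSL2 ℤ) (h : ac x < 0) : 0 < ac (q U ^ 2 * x) := by
  obtain ⟨g, rfl⟩ := QuotientGroup.mk'_surjective _ x
  rw [← map_pow, ← map_mul]
  rw [ac_q] at *
  rw [mul_col, mul_col, show (U ^ 2) 0 0 = -1 by decide, show (U ^ 2) 0 1 = 1 by decide, show (U ^ 2) 1 0 = -1 by decide, show (U ^ 2) 1 1 = 0 by decide]
  nlinarith [sq_nonneg (g 0 0)]

open scoped Pointwise in
lemma inj : Function.Injective (Monoid.CoprodI.lift F) := by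
  refine Monoid.CoprodI.lift_injective_of_ping_pong F (Or.inr ⟨false, ?_⟩) X ?_ ?_ ?_
  · have : Cardinal.mk (H false) = 3 := by
      change Cardinal.mk (Fin 3) = 3
      simp
    exact this.ge
  · rintro (_ | _)
    · refine ⟨q (U * ModularGroup.S), ?_⟩
      change 0 < ac _
      rw [ac_q]
      decide
    · refine ⟨q (ModularGroup.S * (U * ModularGroup.S)), ?_⟩
      change ac _ < 0
      rw [ac_q]
      decide
  · have key : Disjoint {x : PSL2 ℤ | ac x < 0} {x | 0 < ac x} := by
      rw [Set.disjoint_left]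
      intro x h1 h2
      rw [Set.mem_setOf_eq] at h1 h2
      exact lt_asymm h1 h2
    rintro (_ | _) (_ | _) h
    · exact absurd rfl h
    · exact key.symm
    · exact key
    · exact absurd rfl h
  · rintro (_ | _) (_ | _) h
    · exact absurd rfl h
    · rintro (x : Fin 3) hx
      rintro _ ⟨y, hy, rfl⟩
      fin_cases x
      · exact absurd rfl hx
      · change 0 < ac (q U ^ 1 * y)
        rw [pow_one]
        exact acU y hy
      · exact acUU y hy
    · rintro (x : Fin 2) hx
      rintro _ ⟨y, hy, rfl⟩
      fin_cases x
      · exact absurd rfl hx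
      · change ac (q ModularGroup.S ^ 1 * y) < 0
        rw [pow_one]
        exact acS y hy
    · exact absurd rfl h

/-- The comparison map. -/
def toI : Monoid.Coprod (H true) (H false) →* Monoid.CoprodI H :=
  Monoid.Coprod.lift Monoid.CoprodI.of Monoid.CoprodI.of

/-- The inverse comparison map. -/
def ofI : Monoid.CoprodI H →* Monoid.Coprod (H true) (H false) :=
  Monoid.CoprodI.lift (fun b => match b with
    | true => Monoid.Coprod.inl
    | false => Monoid.Coprod.inr)

lemma ofI_toI : ofI.comp toI = MonoidHom.id _ := by
  apply Monoid.Coprod.hom_ext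
  · ext x
    simp [ofI, toI]
  · ext x
    simp [ofI, toI]

/-- The map. -/
def Phi : Monoid.Coprod (H true) (H false) →* PSL2 ℤ := (Monoid.CoprodI.lift F).comp toI

lemma Phi_inj : Function.Injective Phi := by
  refine inj.comp (Function.LeftInverse.injective (g := ofI) fun x => ?_)
  exact DFunLike.congr_fun ofI_toI x

lemma F_one (b : Bool) : F b (Multiplicative.ofAdd 1) = gen b := by
  cases b <;> exact pow_one _

lemma Phi_surj : Function.Surjective Phi := by
  rw [← MonoidHom.range_eq_top]
  have hS : q ModularGroup.S ∈ Phi.range :=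
    ⟨Monoid.Coprod.inl (Multiplicative.ofAdd 1), F_one true⟩
  have hU : q U ∈ Phi.range :=
    ⟨Monoid.Coprod.inr (Multiplicative.ofAdd 1), F_one false⟩
  have hT : ModularGroup.T = (ModularGroup.S * U)⁻¹ := by
    decide
  have : (⊤ : Subgroup (SL2 ℤ)) ≤ Phi.range.comap q := by
    rw [← SpecialLinearGroup.SL2Z_generators, Subgroup.closure_le]
    rintro x (rfl | rfl)
    · exact hS
    · change q ModularGroup.T ∈ Phi.range
      rw [hT, map_inv, map_mul]
      exact inv_mem (mul_mem hS hU)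
  rw [eq_top_iff]
  intro x _
  obtain ⟨g, rfl⟩ := QuotientGroup.mk'_surjective _ x
  exact this (Subgroup.mem_top g)

end PSLAux

/-- The modular group `PSL₂(ℤ)` is isomorphic to the free product `C₂ ∗ C₃` of a cyclic
group of order 2 and a cyclic group of order 3. -/
theorem psl2z_free_product_c2_c3 :
    Nonempty (PSL2 ℤ ≃*
      Monoid.Coprod (Multiplicative (ZMod 2)) (Multiplicative (ZMod 3))) := by
  exact ⟨(MulEquiv.ofBijective PSLAux.Phi ⟨PSLAux.Phi_inj, PSLAux.Phi_surj⟩).symm⟩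
end

section
/- For every imaginary quadratic field K with ring of integers O_K, the Bianchi group PSL₂(O_K) has a finite-index subgroup that is not of congruence type: there exists a finite-index subgroup Γ ≤ PSL₂(O_K) such that for every nonzero ideal I of O_K, Γ does not contain the image in PSL₂(O_K) of the kernel of the reduction homomorphism SL₂(O_K) → SL₂(O_K/I). -/
open NumberField

section Wall
open Matrix
variable {d : ℤ}

abbrev SLZ (d : ℤ) := Matrix.SpecialLinearGroup (Fin 2) (ℤ√d)

def wallMat (g : SLZ d) : Matrix (Fin 2) (Fin 2) (ℤ√d) :=
  g.1 * !![0, 1; -1, 0] * (g.1)ᴴ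

def Wall (d : ℤ) : Set (Matrix (Fin 2) (Fin 2) (ℤ√d)) := Set.range wallMat

lemma wallMat_mul (g h : SLZ d) : g.1 * wallMat h * (g.1)ᴴ = wallMat (g * h) := by
  simp [wallMat, Matrix.conjTranspose_mul, Matrix.mul_assoc]

def wact (g : SLZ d) (x : Wall d) : Wall d :=
  ⟨g.1 * x.1 * (g.1)ᴴ, by
    obtain ⟨h, hh⟩ := x.2
    exact ⟨g * h, by rw [← hh, wallMat_mul]⟩⟩

lemma wact_mul (g h : SLZ d) (x : Wall d) : wact (g * h) x = wact g (wact h x) := by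
  apply Subtype.ext
  simp [wact, Matrix.conjTranspose_mul, Matrix.mul_assoc]

lemma wact_one (x : Wall d) : wact 1 x = x := by
  apply Subtype.ext
  simp [wact]

def wequiv (g : SLZ d) : Wall d ≃ Wall d where
  toFun := wact g
  invFun := wact g⁻¹
  left_inv x := by rw [← wact_mul]; simp [wact_one]
  right_inv x := by rw [← wact_mul]; simp [wact_one]


/-- Basic shape of wall matrices. -/
lemma wall_props (x : Wall d) : (x.1 0 0).re = 0 ∧ (x.1 1 1).re = 0 ∧
    x.1 1 0 = - star (x.1 0 1) ∧ 2 ∣ (x.1 0 0).im ∧ 2 * d ∣ (x.1 0 1).re - 1 ∧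
    (x.1 0 1).re ^ 2 - d * (x.1 0 1).im ^ 2 = 1 - d * (x.1 0 0).im * (x.1 1 1).im := by
  obtain ⟨x, g, rfl⟩ := x
  have hdet := g.2
  have hx : (wallMat g).det = 1 := by
    simp [wallMat, Matrix.det_conjTranspose, hdet, Matrix.det_fin_two_of]
  have h00 : wallMat g 0 0 = g.1 0 0 * star (g.1 0 1) - g.1 0 1 * star (g.1 0 0) := by
    simp [wallMat, Matrix.mul_apply, Fin.sum_univ_two]; ring
  have h01 : wallMat g 0 1 = g.1 0 0 * star (g.1 1 1) - g.1 0 1 * star (g.1 1 0) := by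
    simp [wallMat, Matrix.mul_apply, Fin.sum_univ_two]; ring
  have h10 : wallMat g 1 0 = g.1 1 0 * star (g.1 0 1) - g.1 1 1 * star (g.1 0 0) := by
    simp [wallMat, Matrix.mul_apply, Fin.sum_univ_two]; ring
  have h11 : wallMat g 1 1 = g.1 1 0 * star (g.1 1 1) - g.1 1 1 * star (g.1 1 0) := by
    simp [wallMat, Matrix.mul_apply, Fin.sum_univ_two]; ring
  rw [Matrix.det_fin_two] at hdet hx
  have hre := congrArg Zsqrtd.re hdet
  have hre' := congrArg Zsqrtd.re hx
  simp only [Zsqrtd.re_sub, Zsqrtd.re_mul, Zsqrtd.re_one] at hre hre'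
  have e1 : (wallMat g 0 0).re = 0 := by rw [h00]; simp; ring
  have e2 : (wallMat g 1 1).re = 0 := by rw [h11]; simp; ring
  have e3 : wallMat g 1 0 = - star (wallMat g 0 1) := by rw [h10, h01]; simp; ring
  refine ⟨e1, e2, e3, ?_, ?_, ?_⟩
  · change 2 ∣ (wallMat g 0 0).im
    rw [h00]
    refine ⟨(g.1 0 0).im * (g.1 0 1).re - (g.1 0 0).re * (g.1 0 1).im, ?_⟩
    simp; ring
  · change 2 * d ∣ (wallMat g 0 1).re - 1
    rw [h01]
    refine ⟨(g.1 0 1).im * (g.1 1 0).im - (g.1 0 0).im * (g.1 1 1).im, ?_⟩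
    simp; linear_combination hre
  · simp only [e1, e2, e3] at hre'
    simp at hre'
    linear_combination hre'

/-- Positivity functional. -/
def wpos (x : Wall d) : Prop := 0 < (x.1 0 0).im + (x.1 1 1).im

lemma wall_prod_nonneg (hd : d ≤ -2) (x : Wall d) : 0 ≤ (x.1 0 0).im * (x.1 1 1).im := by
  obtain ⟨-, -, -, -, -, h⟩ := wall_props x
  by_contra hc
  push Not at hc
  nlinarith [sq_nonneg (x.1 0 1).re, sq_nonneg (x.1 0 1).im]

/-- diagonal entries of the translate -/
lemma wact_row (g : SLZ d) (x : Wall d) (i : Fin 2) : ((wact g x).1 i i).im =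
    (x.1 0 0).im * (g.1 i 0).norm + (x.1 1 1).im * (g.1 i 1).norm
      + 2 * (g.1 i 0 * x.1 0 1 * star (g.1 i 1)).im := by
  obtain ⟨e1, e2, e3, -, -, -⟩ := wall_props x
  have : (wact g x).1 i i = g.1 i 0 * x.1 0 0 * star (g.1 i 0) + g.1 i 0 * x.1 0 1 * star (g.1 i 1)
     + g.1 i 1 * x.1 1 0 * star (g.1 i 0) + g.1 i 1 * x.1 1 1 * star (g.1 i 1) := by
    simp [wact, Matrix.mul_apply, Fin.sum_univ_two]; ring
  rw [this, e3]
  simp [e1, e2, Zsqrtd.norm_def]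
  ring

/-- The key inequality. -/
lemma key_ineq (hd : d ≤ -2) (A C : ℤ) (B a b : ℤ√d)
    (hB : B.norm = 1 - d * A * C)
    (h : (A * a.norm + C * b.norm) ^ 2 ≤ (2 * (a * B * star b).im) ^ 2) :
    (A * a.norm - C * b.norm) ^ 2 ≤ 4 * a.norm * b.norm := by
  have h1 : -d * (a * B * star b).im ^ 2 ≤ a.norm * b.norm * (1 - d * A * C) := by
    have : (a * B * star b).norm = a.norm * b.norm * (1 - d * A * C) := by
      rw [Zsqrtd.norm_mul, Zsqrtd.norm_mul, hB, Zsqrtd.norm_conj]; ring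
    rw [← this, Zsqrtd.norm_def]
    nlinarith [sq_nonneg (a * B * star b).re]
  have h2 : 0 ≤ a.norm * b.norm :=
    mul_nonneg (Zsqrtd.norm_nonneg (by omega) _) (Zsqrtd.norm_nonneg (by omega) _)
  generalize a.norm = p at *
  generalize b.norm = q at *
  generalize (a * B * star b).im = t at *
  have h3 : -d * (A * p + C * q) ^ 2 ≤ -d * (2 * t) ^ 2 := mul_le_mul_of_nonneg_left h (by omega)
  have h4 : -d * (A * p - C * q) ^ 2 ≤ 4 * (p * q) := by nlinarith
  nlinarith [sq_nonneg (A * p - C * q)]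

lemma det_norm_ne (g : SLZ d) :
    (g.1 0 0).norm * (g.1 1 1).norm - (g.1 0 1).norm * (g.1 1 0).norm ≠ 0 := by
  have hdet := g.2
  rw [Matrix.det_fin_two] at hdet
  rw [← Zsqrtd.norm_mul, ← Zsqrtd.norm_mul, sub_eq_iff_eq_add.mp hdet]
  generalize g.1 0 1 * g.1 1 0 = z
  simp [Zsqrtd.norm_def]
  intro h
  have : 2 * z.re + 1 = 0 := by linear_combination h
  omega

lemma sq_aux (A C A' n : ℤ) (p q : ℤ) (hp : 0 ≤ p) (hq : 0 ≤ q) (e : A' = A * p + C * q + n)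
    (h : (0 ≤ A ∧ 0 ≤ C ∧ A' ≤ 0) ∨ (A ≤ 0 ∧ C ≤ 0 ∧ 0 ≤ A')) :
    (A * p + C * q) ^ 2 ≤ n ^ 2 := by
  rcases h with ⟨h1, h2, h3⟩ | ⟨h1, h2, h3⟩
  · have h4 := mul_nonneg h1 hp
    have h5 := mul_nonneg h2 hq
    rw [sq_le_sq, abs_of_nonneg (by linarith)]
    exact le_trans (by linarith) (neg_le_abs n)
  · have h4 := mul_nonneg (neg_nonneg.2 h1) hp
    have h5 := mul_nonneg (neg_nonneg.2 h2) hq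
    rw [sq_le_sq, abs_of_nonpos (by linarith)]
    exact le_trans (by linarith) (le_abs_self n)

lemma sign_aux {x y : ℤ} (h : 0 ≤ x * y) : (0 < x + y → 0 ≤ x ∧ 0 ≤ y) ∧
    (¬ 0 < x + y → x ≤ 0 ∧ y ≤ 0) := by
  constructor
  · intro h1
    constructor <;> by_contra hc <;> push Not at hc <;> nlinarith
  · intro h1
    constructor <;> by_contra hc <;> push Not at hc <;> nlinarith

lemma bound_aux (hd : d ≤ -2) (g : SLZ d) : ∃ K : ℤ, ∀ x : Wall d,
    ¬ (wpos (wact g x) ↔ wpos x) → |(x.1 0 0).im| ≤ K ∧ |(x.1 1 1).im| ≤ K := by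
  have nn : ∀ z : ℤ√d, 0 ≤ z.norm := fun z => Zsqrtd.norm_nonneg (by omega) z
  set p := (g.1 0 0).norm with hp
  set q := (g.1 0 1).norm with hq
  set r := (g.1 1 0).norm with hr
  set s := (g.1 1 1).norm with hs
  have hp0 : 0 ≤ p := nn _
  have hq0 : 0 ≤ q := nn _
  have hr0 : 0 ≤ r := nn _
  have hs0 : 0 ≤ s := nn _
  have hD : p * s - q * r ≠ 0 := det_norm_ne g
  refine ⟨(p + q + r + s) * (4 * p * q + 4 * r * s), fun x hx => ?_⟩
  set A := (x.1 0 0).im with hA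
  set C := (x.1 1 1).im with hC
  have hB : (x.1 0 1).norm = 1 - d * A * C := by
    obtain ⟨-, -, -, -, -, h⟩ := wall_props x
    rw [Zsqrtd.norm_def]; linear_combination h
  have r0 := wact_row g x 0
  have r1 := wact_row g x 1
  have s1 := sign_aux (wall_prod_nonneg hd x)
  have s2 := sign_aux (wall_prod_nonneg hd (wact g x))
  have hcase : (wpos x ∧ ¬ wpos (wact g x)) ∨ (¬ wpos x ∧ wpos (wact g x)) := by tauto
  have k1 : (A * p - C * q) ^ 2 ≤ 4 * p * q := by
    apply key_ineq hd A C _ _ _ hB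
    apply sq_aux A C _ _ _ _ hp0 hq0 r0
    rcases hcase with ⟨h1, h2⟩ | ⟨h1, h2⟩
    · exact Or.inl ⟨(s1.1 h1).1, (s1.1 h1).2, (s2.2 h2).1⟩
    · exact Or.inr ⟨(s1.2 h1).1, (s1.2 h1).2, (s2.1 h2).1⟩
  have k2 : (A * r - C * s) ^ 2 ≤ 4 * r * s := by
    apply key_ineq hd A C _ _ _ hB
    apply sq_aux A C _ _ _ _ hr0 hs0 r1
    rcases hcase with ⟨h1, h2⟩ | ⟨h1, h2⟩
    · exact Or.inl ⟨(s1.1 h1).1, (s1.1 h1).2, (s2.2 h2).2⟩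
    · exact Or.inr ⟨(s1.2 h1).1, (s1.2 h1).2, (s2.1 h2).2⟩
  have absq : ∀ z w : ℤ, z ^ 2 ≤ w → |z| ≤ w := fun z w h => by
    refine le_trans ?_ h
    rw [← sq_abs]
    exact Int.le_self_sq |z|
  have k1' := absq _ _ k1
  have k2' := absq _ _ k2
  have hD1 : 1 ≤ |p * s - q * r| := Int.one_le_abs hD
  have pq0 : 0 ≤ 4 * p * q := by positivity
  have rs0 : 0 ≤ 4 * r * s := by positivity
  have main : ∀ X u v y z P Q : ℤ, 0 ≤ u → 0 ≤ v → |y| ≤ P → |z| ≤ Q →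
      X * (p * s - q * r) = u * y - v * z → |X| ≤ u * P + v * Q := by
    intro X u v y z P Q hu hv hy hz e
    calc |X| ≤ |X| * |p * s - q * r| := le_mul_of_one_le_right (abs_nonneg _) hD1
      _ = |u * y - v * z| := by rw [← abs_mul, e]
      _ ≤ |u * y| + |v * z| := abs_sub _ _
      _ = u * |y| + v * |z| := by rw [abs_mul, abs_mul, abs_of_nonneg hu, abs_of_nonneg hv]
      _ ≤ u * P + v * Q := by gcongr
  have b1 := main A s q _ _ _ _ hs0 hq0 k1' k2' (by ring)
  have b2 := main C r p _ _ _ _ hr0 hp0 k1' k2' (by ring)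
  generalize 4 * p * q = P at *
  generalize 4 * r * s = Q at *
  clear_value A C p q r s
  have t1 := mul_nonneg hp0 pq0
  have t2 := mul_nonneg hq0 pq0
  have t3 := mul_nonneg hr0 pq0
  have t4 := mul_nonneg hs0 pq0
  have t5 := mul_nonneg hp0 rs0
  have t6 := mul_nonneg hq0 rs0
  have t7 := mul_nonneg hr0 rs0
  have t8 := mul_nonneg hs0 rs0
  have hK : (p + q + r + s) * (P + Q) = p*P+q*P+r*P+s*P+p*Q+q*Q+r*Q+s*Q := by ring
  rw [hK]
  constructor
  · linarith
  · linarith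

lemma wall_ext {x y : Wall d} (h1 : (x.1 0 0).im = (y.1 0 0).im)
    (h2 : (x.1 1 1).im = (y.1 1 1).im) (e : x.1 0 1 = y.1 0 1) : x = y := by
  obtain ⟨x1, x2, x3, -⟩ := wall_props x
  obtain ⟨y1, y2, y3, -⟩ := wall_props y
  apply Subtype.ext
  rw [Matrix.eta_fin_two x.1, Matrix.eta_fin_two y.1, x3, y3, e,
    Zsqrtd.ext (x1.trans y1.symm) h1, Zsqrtd.ext (x2.trans y2.symm) h2]

lemma finite_aux (hd : d ≤ -2) (g : SLZ d) : {x : Wall d | ¬ (wpos (wact g x) ↔ wpos x)}.Finite := by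
  obtain ⟨K, hK⟩ := bound_aux hd g
  let F : Wall d → ℤ × ℤ × ℤ × ℤ := fun x =>
    ((x.1 0 0).im, (x.1 1 1).im, (x.1 0 1).re, (x.1 0 1).im)
  have hF : Function.Injective F := by
    intro x y h
    simp only [F, Prod.mk.injEq] at h
    obtain ⟨h1, h2, h3, h4⟩ := h
    exact wall_ext h1 h2 (Zsqrtd.ext h3 h4)
  set L := 1 - d * (K * K)
  have hbox : (Set.Icc (-K) K ×ˢ Set.Icc (-K) K ×ˢ Set.Icc (-L) L ×ˢ Set.Icc (-L) L).Finite :=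
    (Set.finite_Icc _ _).prod ((Set.finite_Icc _ _).prod ((Set.finite_Icc _ _).prod
      (Set.finite_Icc _ _)))
  refine (hbox.preimage (f := F) hF.injOn).subset ?_
  intro x hx
  obtain ⟨h1, h2⟩ := hK x hx
  obtain ⟨-, -, -, -, -, h⟩ := wall_props x
  have hAC : (x.1 0 0).im * (x.1 1 1).im ≤ K * K := by
    refine (le_abs_self _).trans ?_
    rw [abs_mul]
    gcongr
    exact (abs_nonneg _).trans h1
  have h3 : (x.1 0 1).re ^ 2 - d * (x.1 0 1).im ^ 2 ≤ L := by rw [h]; simp only [L]; nlinarith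
  have h4 : (x.1 0 1).re ^ 2 ≤ L := by nlinarith [sq_nonneg (x.1 0 1).im]
  have h5 : (x.1 0 1).im ^ 2 ≤ L := by nlinarith [sq_nonneg (x.1 0 1).im, sq_nonneg (x.1 0 1).re]
  have absq : ∀ z w : ℤ, z ^ 2 ≤ w → |z| ≤ w := fun z w h => by
    refine le_trans ?_ h
    rw [← sq_abs]
    exact Int.le_self_sq |z|
  exact ⟨abs_le.1 h1, abs_le.1 h2, abs_le.1 (absq _ _ h4), abs_le.1 (absq _ _ h5)⟩

open Classical in
noncomputable def wind (x : Wall d) : ℤ := if wpos x then 1 else 0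

lemma wind_congr {x y : Wall d} (h : wpos x ↔ wpos y) : wind x = wind y := by
  unfold wind
  by_cases hx : wpos x
  · rw [if_pos hx, if_pos (h.1 hx)]
  · rw [if_neg hx, if_neg (fun hy => hx (h.2 hy))]

lemma finite_supp (hd : d ≤ -2) (g : SLZ d) :
    (Function.support fun x : Wall d => wind (wact g x) - wind x).Finite := by
  refine (finite_aux hd g).subset ?_
  intro x hx h
  apply hx
  simp only [wind_congr h, sub_self]

noncomputable def wphi (hd : d ≤ -2) : SLZ d →* Multiplicative ℤ where
  toFun g := Multiplicative.ofAdd (∑ᶠ x : Wall d, (wind (wact g x) - wind x))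
  map_one' := by simp [wact_one]
  map_mul' g h := by
    rw [← ofAdd_add]
    congr 1
    rw [← finsum_comp_equiv (wequiv h) (f := fun x => wind (wact g x) - wind x), ← finsum_add_distrib]
    · apply finsum_congr
      intro x
      simp [wequiv, wact_mul]
    · exact (finite_supp hd g).preimage (f := wequiv h) (wequiv h).injective.injOn
    · exact finite_supp hd h

def tau (d : ℤ) (n : ℤ) : SLZ d := ⟨!![1, ⟨0, n⟩; 0, 1], by simp [Matrix.det_fin_two_of]⟩

lemma wphi_tau (hd : d ≤ -2) : wphi hd (tau d 1) = Multiplicative.ofAdd (-1) := by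
  change Multiplicative.ofAdd _ = _
  congr 1
  have hC : ∀ x : Wall d, ((wact (tau d 1) x).1 1 1).im = (x.1 1 1).im := by
    intro x; rw [wact_row]; simp [tau]
  have hA : ∀ x : Wall d, (x.1 1 1).im = 0 → x.1 0 1 = 1 ∧
      ((wact (tau d 1) x).1 0 0).im = (x.1 0 0).im - 2 := by
    intro x hx
    have hx1 : x.1 0 1 = 1 := by
      obtain ⟨-, -, -, -, h1, h2⟩ := wall_props x
      rw [hx] at h2
      have h3 : (x.1 0 1).im = 0 := by
        by_contra hc
        have : 0 < (x.1 0 1).im ^ 2 := by positivity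
        nlinarith [sq_nonneg (x.1 0 1).re]
      rw [h3] at h2
      have h4 : ((x.1 0 1).re - 1) * ((x.1 0 1).re + 1) = 0 := by linear_combination h2
      rcases mul_eq_zero.1 h4 with h5 | h5
      · exact Zsqrtd.ext (by simp; omega) (by simp [h3])
      · exfalso
        have h6 : (x.1 0 1).re - 1 = -2 := by omega
        rw [h6] at h1
        have := Int.le_of_dvd (by norm_num) ((neg_dvd.2 (dvd_neg.2 h1) : -(2 * d) ∣ - -2))
        omega
    refine ⟨hx1, ?_⟩
    rw [wact_row, hx, hx1]
    simp [tau, Zsqrtd.norm_def]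
    try ring
  let x0 : Wall d := ⟨wallMat (tau d (-1)), _, rfl⟩
  have x00 : (x0.1 0 0).im = 2 := by
    simp [x0, wallMat, tau, Matrix.mul_apply, Fin.sum_univ_two]
  have x01 : x0.1 0 1 = 1 := by
    simp [x0, wallMat, tau, Matrix.mul_apply, Fin.sum_univ_two]
  have x11 : (x0.1 1 1).im = 0 := by
    simp [x0, wallMat, tau, Matrix.mul_apply, Fin.sum_univ_two]
  rw [finsum_eq_single _ x0]
  · have h1 : wpos x0 := by simp [wpos, x00, x11]
    have h2 : ¬ wpos (wact (tau d 1) x0) := by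
      simp [wpos, hC, (hA x0 x11).2, x00, x11]
    simp [wind, h1, h2]
  · intro x hx
    by_cases hc : (x.1 1 1).im = 0
    · obtain ⟨h1, h2⟩ := hA x hc
      obtain ⟨e1, e2, e3, ⟨k, h3⟩, -, -⟩ := wall_props x
      have h4 : (x.1 0 0).im ≠ 2 := by
        intro h4
        apply hx
        exact wall_ext (h4.trans x00.symm) (hc.trans x11.symm) (h1.trans x01.symm)
      have : wpos (wact (tau d 1) x) ↔ wpos x := by
        simp only [wpos, hC, h2, hc]
        omega
      rw [wind_congr this, sub_self]
    · have s1 := wall_prod_nonneg hd x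
      have s2 := wall_prod_nonneg hd (wact (tau d 1) x)
      have : wpos (wact (tau d 1) x) ↔ wpos x := by
        have t1 := sign_aux s1
        have t2 := sign_aux s2
        rw [hC] at t2
        simp only [wpos, hC]
        constructor
        · intro h
          by_contra h'
          have := t1.2 h'
          have := t2.1 h
          omega
        · intro h
          by_contra h'
          have := t1.1 h
          have := t2.2 h'
          omega
      rw [wind_congr this, sub_self]

end Wall

lemma tau_pow (d : ℤ) (n : ℕ) : tau d 1 ^ n = tau d n := by
  induction n with
  | zero =>
    apply Subtype.ext
    rw [Matrix.eta_fin_two (tau d ((0:ℕ):ℤ)).1, pow_zero, Matrix.SpecialLinearGroup.coe_one,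
      Matrix.one_fin_two]
    simp [tau]
    rfl
  | succ n ih =>
    rw [pow_succ, ih]
    apply Subtype.ext
    rw [Matrix.SpecialLinearGroup.coe_mul]
    simp only [tau, Matrix.mul_fin_two]
    have e : (1 : ℤ√d) * ⟨0, 1⟩ + ⟨0, n⟩ * 1 = ⟨0, ((n + 1 : ℕ) : ℤ)⟩ := by
      simp [add_comm]
    rw [e]
    simp

lemma exists_unit_lift (M : ℕ) (hM : M ≠ 0) (h5 : 5 ∣ M) : ∃ (a : ℕ) (v k : ℤ),
    (a : ZMod 5) = 2 ∧ (a : ℤ) * v - M * M * k = 1 := by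
  have : NeZero (M * M) := ⟨mul_ne_zero hM hM⟩
  have hd : 5 ∣ M * M := h5.mul_right M
  obtain ⟨u, hu⟩ := ZMod.unitsMap_surjective hd (ZMod.unitOfCoprime 2 (by decide))
  have hu' : ((u : ZMod (M * M)).cast : ZMod 5) = 2 := by
    have := congrArg Units.val hu
    simpa [ZMod.unitsMap] using this
  obtain ⟨a, ha⟩ : ∃ a : ℕ, (a : ZMod (M*M)) = u := ⟨(u : ZMod (M*M)).val, ZMod.natCast_zmod_val _⟩
  obtain ⟨v, hv⟩ : ∃ v : ℤ, (v : ZMod (M*M)) = (u⁻¹ : (ZMod (M*M))ˣ) :=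
    ⟨_, ZMod.intCast_zmod_cast _⟩
  have h1 : ((a * v - 1 : ℤ) : ZMod (M*M)) = 0 := by
    push_cast
    rw [ha, hv]; simp
  obtain ⟨k, hk⟩ := (ZMod.intCast_zmod_eq_zero_iff_dvd _ _).1 h1
  refine ⟨a, v, k, ?_, ?_⟩
  · rw [← hu', ← ha, ZMod.cast_natCast hd]
  · push_cast at hk; linear_combination hk

noncomputable def wpsi {d : ℤ} (hd : d ≤ -2) : SLZ d →* Multiplicative (ZMod 5) :=
  (AddMonoidHom.toMultiplicative (Int.castAddHom (ZMod 5))).comp (wphi hd)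

lemma wpsi_tau {d : ℤ} (hd : d ≤ -2) : wpsi hd (tau d 1) = Multiplicative.ofAdd (-1) := by
  simp [wpsi, wphi_tau]

lemma exists_elt {d : ℤ} (hd : d ≤ -2) (M : ℕ) (hM : M ≠ 0) (h5 : 5 ∣ M) :
    ∃ e : SLZ d, (wpsi hd e) ^ 2 ≠ 1 ∧ ∀ (S : Type) [CommRing S] (ρ : ℤ√d →+* S), ρ M = 0 →
      Matrix.SpecialLinearGroup.map ρ e = 1 := by
  obtain ⟨a, v, k, ha, hk⟩ := exists_unit_lift M hM h5
  have hk' : (a : ℤ√d) * v - M * M * k = 1 := by exact_mod_cast congrArg (Int.cast : ℤ → ℤ√d) hk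
  let h : SLZ d := ⟨!![(a : ℤ√d), M * k; M, v], by
    rw [Matrix.det_fin_two_of]; linear_combination hk'⟩
  refine ⟨h * tau d 1 * h⁻¹ * (tau d 1 ^ (a ^ 2))⁻¹, ?_, ?_⟩
  · rw [map_mul, map_mul, map_mul, map_inv, map_inv, map_pow, wpsi_tau,
      mul_inv_cancel_comm, ← ofAdd_nsmul, ← ofAdd_neg, ← ofAdd_add, ← ofAdd_nsmul, ← ofAdd_zero]
    intro hc
    have hc := Multiplicative.ofAdd.injective hc
    simp only [nsmul_eq_mul] at hc
    push_cast at hc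
    rw [ha] at hc
    revert hc
    decide
  · intro S _ ρ hρ
    rw [map_mul, map_mul, map_mul, map_inv, map_inv, mul_inv_eq_one, mul_inv_eq_iff_eq_mul,
      tau_pow, ← map_mul, ← map_mul]
    have hρ' : (M : S) = 0 := by simpa using hρ
    have e1 : ρ ⟨0, ((a ^ 2 : ℕ) : ℤ)⟩ = (a : S) ^ 2 * ρ ⟨0, 1⟩ := by
      have : (⟨0, ((a ^ 2 : ℕ) : ℤ)⟩ : ℤ√d) = (a : ℤ√d) ^ 2 * ⟨0, 1⟩ := by
        rw [← Nat.cast_pow, Zsqrtd.ext_iff, Zsqrtd.re_mul, Zsqrtd.im_mul, Zsqrtd.re_natCast,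
          Zsqrtd.im_natCast]
        simp
      rw [this]; simp
    have e2 : (a : S) * v = 1 := by
      have := congrArg ρ hk'
      simpa [hρ'] using this
    apply Subtype.ext
    rw [Matrix.SpecialLinearGroup.map_apply_coe, Matrix.SpecialLinearGroup.map_apply_coe,
      RingHom.mapMatrix_apply, RingHom.mapMatrix_apply, Matrix.SpecialLinearGroup.coe_mul,
      Matrix.SpecialLinearGroup.coe_mul]
    simp only [h, tau, Matrix.mul_fin_two]
    conv_lhs => rw [Matrix.eta_fin_two (Matrix.map _ _)]
    conv_rhs => rw [Matrix.eta_fin_two (Matrix.map _ _)]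
    simp only [Matrix.map_apply, Matrix.of_apply, Matrix.cons_val', Matrix.cons_val_zero,
      Matrix.cons_val_one, Matrix.cons_val_fin_one, map_add, map_mul, map_natCast, map_intCast,
      map_one, map_zero, e1, hρ']
    have e3 : (a : S) * ρ ⟨0, 1⟩ = a ^ 2 * ρ ⟨0, 1⟩ * v := by
      linear_combination (- (a : S) * ρ ⟨0, 1⟩) * e2
    simp [e3]

lemma final_aux {O : Type} [CommRing O] [IsDomain O] [CharZero O]
    (hfin : ∀ I : Ideal O, I ≠ ⊥ → Finite (O ⧸ I))
    (hint : ∀ I : Ideal O, I ≠ ⊥ → ∃ n : ℕ, n ≠ 0 ∧ (n : O) ∈ I)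
    (d : ℤ) (hd : d ≤ -2) (ω : O) (hω : ω * ω = d) (M : ℕ) (hM : M ≠ 0)
    (hR : ∀ x : O, ∃ a b : ℤ, M * x = a + b * ω) :
    ∃ Γ : Subgroup (Matrix.SpecialLinearGroup (Fin 2) O ⧸
        Subgroup.center (Matrix.SpecialLinearGroup (Fin 2) O)), Γ.FiniteIndex ∧
      ∀ I : Ideal O, I ≠ ⊥ →
        ¬ ((MonoidHom.ker (Matrix.SpecialLinearGroup.map (n := Fin 2) (Ideal.Quotient.mk I))).map
            (QuotientGroup.mk' (Subgroup.center (Matrix.SpecialLinearGroup (Fin 2) O))) ≤ Γ) := by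
  let f : ℤ√d →+* O := Zsqrtd.lift ⟨ω, hω⟩
  have hf : Function.Injective f := Zsqrtd.lift_injective _ (fun n hn => by
    nlinarith [mul_self_nonneg n])
  let j : SLZ d →* Matrix.SpecialLinearGroup (Fin 2) O := Matrix.SpecialLinearGroup.map f
  have hj : Function.Injective j := by
    intro x y hxy
    apply Subtype.ext
    have := congrArg (fun z : Matrix.SpecialLinearGroup (Fin 2) O => z.1) hxy
    exact Matrix.map_injective hf this
  have hrange : j.range.FiniteIndex := by
    let J : Ideal O := Ideal.span {(M : O)}
    have hJ : J ≠ ⊥ := by simp [J, hM]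
    have := hfin J hJ
    have : Finite (Matrix.SpecialLinearGroup (Fin 2) (O ⧸ J)) := Subtype.finite
    have hker : (MonoidHom.ker (Matrix.SpecialLinearGroup.map (n := Fin 2)
        (Ideal.Quotient.mk J))).FiniteIndex := Subgroup.finiteIndex_ker _
    refine Subgroup.finiteIndex_of_le (H := MonoidHom.ker (Matrix.SpecialLinearGroup.map
      (n := Fin 2) (Ideal.Quotient.mk J))) ?_
    intro g hg
    have hent : ∀ i k, ∃ z : ℤ√d, f z = g.1 i k := by
      intro i k
      have h1 := congrArg (fun z : Matrix.SpecialLinearGroup (Fin 2) (O ⧸ J) => z.1 i k)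
        (MonoidHom.mem_ker.1 hg)
      have h2 : Ideal.Quotient.mk J (g.1 i k) =
          Ideal.Quotient.mk J ((1 : Matrix (Fin 2) (Fin 2) O) i k) := by
        refine (show _ = (1 : Matrix (Fin 2) (Fin 2) (O ⧸ J)) i k from h1).trans ?_
        simp [Matrix.one_apply, apply_ite (Ideal.Quotient.mk J)]
      rw [Ideal.Quotient.eq, Ideal.mem_span_singleton] at h2
      obtain ⟨x, hx⟩ := h2
      obtain ⟨a, b, hab⟩ := hR x
      have h3 : g.1 i k = (1 : Matrix (Fin 2) (Fin 2) O) i k + (a + b * ω) := by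
        rw [← hab]; linear_combination hx
      refine ⟨(1 : Matrix (Fin 2) (Fin 2) (ℤ√d)) i k + ⟨a, b⟩, ?_⟩
      rw [h3, map_add]
      congr 1
      simp [Matrix.one_apply, apply_ite f]
    choose z hz using hent
    have hz' : f.mapMatrix (Matrix.of z) = g.1 := by
      ext i k; exact hz i k
    refine ⟨⟨Matrix.of z, ?_⟩, Subtype.ext hz'⟩
    apply hf
    rw [RingHom.map_det, hz', map_one]
    exact g.2
  let ψ := wpsi hd
  let π := QuotientGroup.mk' (Subgroup.center (Matrix.SpecialLinearGroup (Fin 2) O))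
  have hΔ : (ψ.ker.map j).FiniteIndex := by
    constructor
    rw [Subgroup.index_map_of_injective _ hj]
    exact mul_ne_zero (Subgroup.finiteIndex_ker ψ).index_ne_zero hrange.index_ne_zero
  refine ⟨(ψ.ker.map j).map π, ⟨?_⟩, ?_⟩
  · exact ne_zero_of_dvd_ne_zero hΔ.index_ne_zero
      (Subgroup.index_map_dvd _ (QuotientGroup.mk'_surjective _))
  intro I hI hle
  obtain ⟨n, hn0, hn⟩ := hint I hI
  obtain ⟨e, he1, he2⟩ := exists_elt hd (5 * n) (by omega) (dvd_mul_right 5 n)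
  have he3 := he2 (O ⧸ I) ((Ideal.Quotient.mk I).comp f) (by
    have h0 : Ideal.Quotient.mk I (n : O) = 0 := Ideal.Quotient.eq_zero_iff_mem.2 hn
    rw [map_natCast] at h0 ⊢
    push_cast
    rw [h0, mul_zero])
  have hmem : j e ∈ MonoidHom.ker (Matrix.SpecialLinearGroup.map (n := Fin 2)
      (Ideal.Quotient.mk I)) := by
    rw [MonoidHom.mem_ker, ← he3]
    apply Subtype.ext
    rfl
  obtain ⟨y', ⟨y, hy, rfl⟩, hy'⟩ := hle ⟨j e, hmem, rfl⟩
  have hc : (j y)⁻¹ * j e ∈ Subgroup.center (Matrix.SpecialLinearGroup (Fin 2) O) :=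
    QuotientGroup.eq.1 hy'
  rw [← map_inv, ← map_mul] at hc
  have hsq : (y⁻¹ * e) ^ 2 = 1 := by
    apply hj
    rw [map_pow, map_one]
    obtain ⟨r, hr, hr'⟩ := Matrix.SpecialLinearGroup.mem_center_iff.1 hc
    apply Subtype.ext
    rw [Matrix.SpecialLinearGroup.coe_pow, ← hr', ← map_pow]
    rw [Fintype.card_fin] at hr
    rw [hr, map_one]
    rfl
  apply he1
  have h7 := congrArg (wpsi hd) hsq
  have hy2 : wpsi hd y = 1 := hy
  rwa [map_pow, map_mul, map_inv, hy2, inv_one, one_mul, map_one] at h7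

lemma nf_aux (K : Type) [Field K] [NumberField K]
    (h2 : Module.finrank ℚ K = 2) (hK : IsEmpty (K →+* ℝ)) :
    ∃ (d : ℤ) (ω : 𝓞 K), d ≤ -2 ∧ ω * ω = d ∧ ∀ x : K, ∃ a b : ℚ, x = a + b * (ω : K) := by
  -- an irrational element
  obtain ⟨x, hx⟩ : ∃ x : K, x ∉ (algebraMap ℚ K).range := by
    by_contra hc
    push Not at hc
    have hs : Function.Surjective (algebraMap ℚ K) := fun x => hc x
    have := (LinearEquiv.ofBijective (Algebra.linearMap ℚ K)
      ⟨(algebraMap ℚ K).injective, hs⟩).finrank_eq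
    rw [h2, Module.finrank_self] at this
    omega
  have span : ∀ y : K, y ∉ (algebraMap ℚ K).range → ∀ z : K, ∃ a b : ℚ, z = a + b * y := by
    intro y hy z
    have hli : LinearIndependent ℚ ![(1 : K), y] := by
      rw [LinearIndependent.pair_iff]
      intro s t hst
      have ht : t = 0 := by
        by_contra ht
        apply hy
        refine ⟨-s / t, ?_⟩
        have ht' : (t : K) ≠ 0 := by exact_mod_cast ht
        simp [Algebra.smul_def] at hst ⊢
        field_simp
        linear_combination -hst
      subst ht
      simpa using hst
    have htop := hli.span_eq_top_of_card_eq_finrank (by simp [h2])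
    have hz : z ∈ Submodule.span ℚ (Set.range ![(1 : K), y]) := by rw [htop]; trivial
    simp only [Matrix.range_cons, Matrix.range_empty, Set.union_empty] at hz
    rw [Set.singleton_union, Submodule.mem_span_pair] at hz
    obtain ⟨a, b, hab⟩ := hz
    exact ⟨a, b, by rw [← hab]; simp [Algebra.smul_def]⟩
  obtain ⟨c, b, hbc⟩ := span x hx (x * x)
  set q : ℚ := b ^ 2 + 4 * c with hq
  have hy : (2 * x - b) * (2 * x - b) = (q : K) := by
    rw [hq]; push_cast; linear_combination 4 * hbc
  have hden : (q : K) * q.den = q.num := by exact_mod_cast Rat.mul_den_eq_num q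
  set w : K := 2 * q.den * (2 * x - b) with hw
  set d : ℤ := 4 * (q.num * q.den) with hd
  have hww : w * w = (d : K) := by
    rw [hw, hd]; push_cast
    linear_combination 4 * (q.den : K) ^ 2 * hy + 4 * q.den * hden
  have hwr : w ∉ (algebraMap ℚ K).range := by
    rintro ⟨r, hr⟩
    apply hx
    refine ⟨(r / (2 * q.den) + b) / 2, ?_⟩
    have : (q.den : K) ≠ 0 := by exact_mod_cast q.den_ne_zero
    simp at hr ⊢
    rw [hr, hw]
    field_simp
    ring
  have hneg : d < 0 := by
    by_contra hc
    push Not at hc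
    obtain ⟨σ⟩ : Nonempty (K →+* ℂ) := inferInstance
    have hσ : σ w * σ w = ((d : ℝ) : ℂ) := by rw [← map_mul, hww]; simp
    have hreal : starRingEnd ℂ (σ w) = σ w := by
      set s := Real.sqrt d
      have hs : (s : ℂ) * s = ((d : ℝ) : ℂ) := by
        rw [← Complex.ofReal_mul, Real.mul_self_sqrt (by exact_mod_cast hc)]
      have : (σ w - s) * (σ w + s) = 0 := by linear_combination hσ - hs
      rcases mul_eq_zero.1 this with h | h
      · rw [sub_eq_zero.1 h, Complex.conj_ofReal]
      · rw [eq_neg_of_add_eq_zero_left h, map_neg, Complex.conj_ofReal]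
    have : ComplexEmbedding.IsReal σ := by
      rw [ComplexEmbedding.isReal_iff]
      ext z
      obtain ⟨a, b, rfl⟩ := span w hwr z
      simp [hreal]
    exact hK.false this.embedding
  have hint : IsIntegral ℤ w := by
    refine IsIntegral.of_pow (n := 2) (by norm_num) ?_
    rw [pow_two, hww]
    exact isIntegral_algebraMap (x := d)
  refine ⟨d, ⟨w, hint⟩, by omega, ?_, span w hwr⟩
  apply RingOfIntegers.ext
  change w * w = algebraMap (𝓞 K) K (d : 𝓞 K)
  rw [hww, map_intCast]

lemma nf_aux2 (K : Type) [Field K] [NumberField K] (ω : 𝓞 K)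
    (h : ∀ x : K, ∃ a b : ℚ, x = a + b * (ω : K)) :
    ∃ M : ℕ, M ≠ 0 ∧ ∀ x : 𝓞 K, ∃ a b : ℤ, (M : 𝓞 K) * x = a + b * ω := by
  have h1 : ∀ x : 𝓞 K, ∃ M : ℕ, M ≠ 0 ∧ ∃ a b : ℤ, (M : 𝓞 K) * x = a + b * ω := by
    intro x
    obtain ⟨a, b, hab⟩ := h x
    change algebraMap (𝓞 K) K x = a + b * algebraMap (𝓞 K) K ω at hab
    refine ⟨a.den * b.den, mul_ne_zero a.den_ne_zero b.den_ne_zero, a.num * b.den, b.num * a.den, ?_⟩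
    have ha : (a : K) * a.den = a.num := by exact_mod_cast Rat.mul_den_eq_num a
    have hb : (b : K) * b.den = b.num := by exact_mod_cast Rat.mul_den_eq_num b
    apply RingOfIntegers.ext
    simp only [map_mul, map_add, map_natCast, map_intCast, Int.cast_mul, Nat.cast_mul, Int.cast_natCast]
    rw [hab, ← ha, ← hb]; ring
  choose N hN A B hAB using h1
  let bs := RingOfIntegers.basis K
  refine ⟨∏ i, N (bs i), Finset.prod_ne_zero_iff.2 fun i _ => hN _, fun x => ?_⟩
  have hd : ∀ i, ∃ t, ∏ i, N (bs i) = N (bs i) * t := fun i =>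
    Finset.dvd_prod_of_mem _ (Finset.mem_univ i)
  choose t ht using hd
  refine ⟨∑ i, bs.repr x i * t i * A (bs i), ∑ i, bs.repr x i * t i * B (bs i), ?_⟩
  conv_lhs => rw [← bs.sum_repr x]
  push_cast
  rw [Finset.mul_sum, Finset.sum_mul, ← Finset.sum_add_distrib]
  refine Finset.sum_congr rfl fun i _ => ?_
  have e := hAB (bs i)
  have ht' : ((∏ i, N (bs i) : ℕ) : 𝓞 K) = N (bs i) * t i := by rw [ht i]; push_cast; rfl
  push_cast at ht'
  rw [ht', zsmul_eq_mul]
  linear_combination ((bs.repr x i : ℤ) : 𝓞 K) * t i * e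

/-- Every Bianchi group `PSL₂(O_K)`, for `K` an imaginary quadratic field (a number field
of degree 2 over `ℚ` with no real embedding), has a finite-index subgroup that is not of
congruence type: it contains the image in `PSL₂(O_K)` of the kernel of the reduction map
`SL₂(O_K) → SL₂(O_K/I)` for no nonzero ideal `I` of `O_K`. -/
theorem bianchi_noncongruence_subgroup (K : Type) [Field K] [NumberField K]
    (h2 : Module.finrank ℚ K = 2) (hK : IsEmpty (K →+* ℝ)) :
    ∃ Γ : Subgroup (PSL2 (𝓞 K)), Γ.FiniteIndex ∧
      ∀ I : Ideal (𝓞 K), I ≠ ⊥ →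
        ¬ ((MonoidHom.ker (Matrix.SpecialLinearGroup.map (Ideal.Quotient.mk I))).map
            (QuotientGroup.mk' (Subgroup.center (SL2 (𝓞 K)))) ≤ Γ) := by
  obtain ⟨d, ω, hd, hω, hspan⟩ := nf_aux K h2 hK
  obtain ⟨M, hM, hR⟩ := nf_aux2 K ω hspan
  refine final_aux (O := 𝓞 K) ?_ ?_ d hd ω hω M hM hR
  · intro I hI
    exact Ideal.finiteQuotientOfFreeOfNeBot I hI
  · intro I hI
    refine ⟨Ideal.absNorm I, ?_, Ideal.absNorm_mem I⟩
    rwa [Ne, Ideal.absNorm_eq_zero_iff]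
end

section
/- For every imaginary quadratic field K with ring of integers O_K, the number of orbits of the natural action of SL₂(O_K) on the projective line ℙ¹(K) (where a matrix acts on a projective point by acting linearly on a representing vector in K²) is equal to the class number of K. -/
open NumberField

/-- The matrix over `K` obtained from a matrix in `SL₂(O_K)` via `O_K ⊆ K`. -/
noncomputable def SLtoMat (K : Type) [Field K] [NumberField K] (g : SL2 (𝓞 K)) :
    Matrix (Fin 2) (Fin 2) K :=
  (g : Matrix (Fin 2) (Fin 2) (𝓞 K)).map (algebraMap (𝓞 K) K)

section aux
open nonZeroDivisors

variable {R : Type*} [CommRing R] [IsDedekindDomain R]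

lemma aux_ne {a b : R} (h : ¬ (a = 0 ∧ b = 0)) : Ideal.span {a, b} ∈ (Ideal R)⁰ := by
  rw [mem_nonZeroDivisors_iff_ne_zero]
  intro h0
  apply h
  have ha : a ∈ Ideal.span {a, b} := Ideal.subset_span (by simp)
  have hb : b ∈ Ideal.span {a, b} := Ideal.subset_span (by simp)
  rw [h0] at ha hb
  exact ⟨by simpa using ha, by simpa using hb⟩

lemma aux_smul (x a b : R) :
    Ideal.span {x} * Ideal.span {a, b} = Ideal.span {x * a, x * b} := by
  rw [Ideal.span_mul_span']
  congr 1
  ext z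
  simp [Set.mem_mul, eq_comm]

lemma aux_exists {a b t : R} {J : Ideal R} (h : t ∈ Ideal.span {a, b} * J) :
    ∃ u ∈ J, ∃ v ∈ J, t = a * u + b * v := by
  rw [Ideal.span_insert, Ideal.sup_mul] at h
  obtain ⟨y, hy, z, hz, rfl⟩ := Submodule.mem_sup.1 h
  obtain ⟨u, hu, rfl⟩ := Ideal.mem_span_singleton_mul.1 hy
  obtain ⟨v, hv, rfl⟩ := Ideal.mem_span_singleton_mul.1 hz
  exact ⟨u, hu, v, hv, rfl⟩

lemma aux_eq {a b c d : R} (h : ¬ (a = 0 ∧ b = 0)) (e : Ideal.span {a, b} = Ideal.span {c, d}) :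
    ∃ p q r s : R, p * s - q * r = 1 ∧ c = p * a + q * b ∧ d = r * a + s * b := by
  obtain ⟨J, hJ⟩ := ClassGroup.mk0_surjective (ClassGroup.mk0 ⟨_, aux_ne h⟩)⁻¹
  obtain ⟨t, ht, hIJ⟩ := (ClassGroup.mk0_eq_mk0_inv_iff).1 hJ
  change (J : Ideal R) * Ideal.span {a, b} = _ at hIJ
  rw [mul_comm] at hIJ
  have htm : t ∈ Ideal.span {a, b} * (J : Ideal R) := by
    rw [hIJ]; exact Ideal.mem_span_singleton_self t
  obtain ⟨u, hu, v, hv, h1⟩ := aux_exists htm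
  rw [e] at htm
  obtain ⟨u', hu', v', hv', h2⟩ := aux_exists htm
  have key : ∀ x ∈ Ideal.span {a, b}, ∀ y ∈ (J : Ideal R), ∃ z, x * y = t * z := by
    intro x hx y hy
    have := Ideal.mul_mem_mul hx hy
    rw [hIJ, Ideal.mem_span_singleton] at this
    exact this
  have ma : a ∈ Ideal.span {a, b} := Ideal.subset_span (by simp)
  have mb : b ∈ Ideal.span {a, b} := Ideal.subset_span (by simp)
  have mc : c ∈ Ideal.span {a, b} := e ▸ Ideal.subset_span (by simp)
  have md : d ∈ Ideal.span {a, b} := e ▸ Ideal.subset_span (by simp)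
  obtain ⟨p1, hp1⟩ := key c mc u hu
  obtain ⟨p2, hp2⟩ := key b mb v' hv'
  obtain ⟨q1, hq1⟩ := key c mc v hv
  obtain ⟨q2, hq2⟩ := key a ma v' hv'
  obtain ⟨r1, hr1⟩ := key d md u hu
  obtain ⟨r2, hr2⟩ := key b mb u' hu'
  obtain ⟨s1, hs1⟩ := key d md v hv
  obtain ⟨s2, hs2⟩ := key a ma u' hu'
  have P : t * (p1 + p2) = c * u + b * v' := by rw [mul_add, hp1, hp2]
  have Q : t * (q1 - q2) = c * v - a * v' := by rw [mul_sub, hq1, hq2]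
  have R' : t * (r1 - r2) = d * u - b * u' := by rw [mul_sub, hr1, hr2]
  have S : t * (s1 + s2) = d * v + a * u' := by rw [mul_add, hs1, hs2]
  refine ⟨p1 + p2, q1 - q2, r1 - r2, s1 + s2, ?_, ?_, ?_⟩
  · apply mul_left_cancel₀ ht
    apply mul_left_cancel₀ ht
    have : t * (t * ((p1 + p2) * (s1 + s2) - (q1 - q2) * (r1 - r2))) =
      (t * (p1 + p2)) * (t * (s1 + s2)) - (t * (q1 - q2)) * (t * (r1 - r2)) := by ring
    rw [this, P, Q, R', S, mul_one]
    have : t * t = (a * u + b * v) * (c * u' + d * v') := by rw [← h1, ← h2]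
    rw [this]; ring
  · apply mul_left_cancel₀ ht
    linear_combination c * h1 - a * P - b * Q
  · apply mul_left_cancel₀ ht
    linear_combination d * h1 - a * R' - b * S

lemma aux_le {a b c d p q r s : R} (h1 : c = p * a + q * b) (h2 : d = r * a + s * b) :
    Ideal.span {c, d} ≤ Ideal.span {a, b} := by
  rw [Ideal.span_le]
  rintro x (rfl | rfl)
  · exact Ideal.mem_span_pair.2 ⟨p, q, h1.symm⟩
  · exact Ideal.mem_span_pair.2 ⟨r, s, h2.symm⟩

lemma aux_iff {a b c d : R} (h : ¬ (a = 0 ∧ b = 0)) (h' : ¬ (c = 0 ∧ d = 0)) :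
    ClassGroup.mk0 ⟨_, aux_ne h⟩ = ClassGroup.mk0 ⟨_, aux_ne h'⟩ ↔
    ∃ p q r s : R, p * s - q * r = 1 ∧ ∃ m n : R, m ≠ 0 ∧ n ≠ 0 ∧
      m * c = n * (p * a + q * b) ∧ m * d = n * (r * a + s * b) := by
  rw [ClassGroup.mk0_eq_mk0_iff]
  constructor
  · rintro ⟨n, m, hn, hm, e⟩
    change Ideal.span {n} * Ideal.span {a, b} = Ideal.span {m} * Ideal.span {c, d} at e
    rw [aux_smul, aux_smul] at e
    obtain ⟨p, q, r, s, h1, h2, h3⟩ := aux_eq (by simpa [hn] using h) e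
    exact ⟨p, q, r, s, h1, m, n, hm, hn, by rw [h2]; ring, by rw [h3]; ring⟩
  · rintro ⟨p, q, r, s, h1, m, n, hm, hn, h2, h3⟩
    refine ⟨n, m, hn, hm, ?_⟩
    change Ideal.span {n} * Ideal.span {a, b} = Ideal.span {m} * Ideal.span {c, d}
    rw [aux_smul, aux_smul]
    apply le_antisymm
    · apply aux_le (p := s) (q := -q) (r := -r) (s := p)
      · linear_combination -n * a * h1 - s * h2 + q * h3
      · linear_combination -n * b * h1 + r * h2 - p * h3
    · exact aux_le (p := p) (q := q) (r := r) (s := s) (by rw [h2]; ring) (by rw [h3]; ring)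

end aux

section aux2
variable (K : Type) [Field K] [NumberField K]

noncomputable def auxV (a b : 𝓞 K) : Fin 2 → K := ![(a : K), (b : K)]

lemma auxV_ne {a b : 𝓞 K} : auxV K a b ≠ 0 ↔ ¬ (a = 0 ∧ b = 0) := by
  rw [not_iff_not]
  simp [auxV]

lemma aux_rep (P : Projectivization K (Fin 2 → K)) :
    ∃ (a b : 𝓞 K) (h : auxV K a b ≠ 0), P = Projectivization.mk K (auxV K a b) h := by
  induction P using Projectivization.ind with
  | h v hv =>
  classical
  obtain ⟨⟨m, hm⟩, hx⟩ := IsLocalization.exist_integer_multiples_of_finset (nonZeroDivisors (𝓞 K))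
    ({v 0, v 1} : Finset K)
  obtain ⟨a, ha⟩ := hx (v 0) (by simp)
  obtain ⟨b, hb⟩ := hx (v 1) (by simp)
  have hm0 : (m : K) ≠ 0 := by simpa using nonZeroDivisors.ne_zero hm
  have e : auxV K a b = (m : K) • v := by
    ext i
    fin_cases i
    · simpa [auxV, Algebra.smul_def] using ha
    · simpa [auxV, Algebra.smul_def] using hb
  refine ⟨a, b, by rw [e]; exact smul_ne_zero hm0 hv, ?_⟩
  rw [eq_comm, Projectivization.mk_eq_mk_iff']
  exact ⟨(m : K), e.symm⟩

lemma aux_mulVec (g : SL2 (𝓞 K)) (a b : 𝓞 K) : (SLtoMat K g).mulVec (auxV K a b) =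
    auxV K (g 0 0 * a + g 0 1 * b) (g 1 0 * a + g 1 1 * b) := by
  ext i
  fin_cases i <;> simp [SLtoMat, auxV, Matrix.mulVec, dotProduct, Fin.sum_univ_two]

lemma aux_rel {a b c d : 𝓞 K} (h : auxV K a b ≠ 0) (h' : auxV K c d ≠ 0) :
    (∃ (g : SL2 (𝓞 K)) (v : Fin 2 → K) (hv : v ≠ 0)
          (hw : (SLtoMat K g).mulVec v ≠ 0),
          Projectivization.mk K _ h = Projectivization.mk K v hv ∧
          Projectivization.mk K _ h' = Projectivization.mk K ((SLtoMat K g).mulVec v) hw) ↔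
    ∃ p q r s : 𝓞 K, p * s - q * r = 1 ∧ ∃ m n : 𝓞 K, m ≠ 0 ∧ n ≠ 0 ∧
      m * c = n * (p * a + q * b) ∧ m * d = n * (r * a + s * b) := by
  constructor
  · rintro ⟨g, v, hv, hw, e1, e2⟩
    have hdet := g.det_coe
    rw [Matrix.det_fin_two] at hdet
    refine ⟨g 0 0, g 0 1, g 1 0, g 1 1, hdet, ?_⟩
    rw [eq_comm, Projectivization.mk_eq_mk_iff'] at e1
    obtain ⟨l, rfl⟩ := e1
    rw [Projectivization.mk_eq_mk_iff'] at e2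
    obtain ⟨k, hk⟩ := e2
    rw [Matrix.mulVec_smul, smul_smul, aux_mulVec] at hk
    obtain ⟨n, m, hm, hnm⟩ := IsFractionRing.div_surjective (A := 𝓞 K) (k * l)
    have hm0 : m ≠ 0 := nonZeroDivisors.ne_zero hm
    have hmK : (m : K) ≠ 0 := by simpa using hm0
    have hkl : k * l ≠ 0 := by
      intro h0
      rw [h0, zero_smul] at hk
      exact h' hk.symm
    refine ⟨m, n, hm0, ?_, ?_, ?_⟩
    · rintro rfl
      simp at hnm
      apply hkl
      simpa using hnm
    · have := congrFun hk 0
      rw [← hnm] at this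
      replace this : algebraMap (𝓞 K) K n / algebraMap (𝓞 K) K m *
        algebraMap (𝓞 K) K (g 0 0 * a + g 0 1 * b) = algebraMap (𝓞 K) K c := this
      apply FaithfulSMul.algebraMap_injective (𝓞 K) K
      rw [map_mul, map_mul, ← this, ← mul_assoc, mul_div_cancel₀ _ hmK]
    · have := congrFun hk 1
      rw [← hnm] at this
      replace this : algebraMap (𝓞 K) K n / algebraMap (𝓞 K) K m *
        algebraMap (𝓞 K) K (g 1 0 * a + g 1 1 * b) = algebraMap (𝓞 K) K d := this
      apply FaithfulSMul.algebraMap_injective (𝓞 K) K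
      rw [map_mul, map_mul, ← this, ← mul_assoc, mul_div_cancel₀ _ hmK]
  · rintro ⟨p, q, r, s, h1, m, n, hm, hn, h2, h3⟩
    have hmK : (m : K) ≠ 0 := by simpa using hm
    have hnK : (n : K) ≠ 0 := by simpa using hn
    let g : SL2 (𝓞 K) := ⟨!![p, q; r, s], by rw [Matrix.det_fin_two_of, h1]⟩
    have e : (m : K) • auxV K c d = (n : K) • (SLtoMat K g).mulVec (auxV K a b) := by
      rw [aux_mulVec]
      have h2' := congrArg (algebraMap (𝓞 K) K) h2
      have h3' := congrArg (algebraMap (𝓞 K) K) h3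
      ext i
      fin_cases i
      · simpa [auxV, g] using h2'
      · simpa [auxV, g] using h3'
    refine ⟨g, auxV K a b, h, ?_, rfl, ?_⟩
    · intro h0
      rw [h0, smul_zero] at e
      exact smul_ne_zero hmK h' e
    · rw [Projectivization.mk_eq_mk_iff']
      refine ⟨(m : K)⁻¹ * n, ?_⟩
      rw [mul_smul, ← e, smul_smul, inv_mul_cancel₀ hmK, one_smul]

end aux2

/-- For an imaginary quadratic field `K` (a number field of degree 2 over `ℚ` with no real
embedding), the number of orbits of the natural action of `SL₂(O_K)` on the projective line
`ℙ¹(K)` (where `g · [v] = [g v]` for a representing vector `v ∈ K² \ {0}`) equals the class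
number of `K`. -/
theorem card_orbits_projective_line_eq_classNumber (K : Type) [Field K] [NumberField K]
    (h2 : Module.finrank ℚ K = 2) (hK : IsEmpty (K →+* ℝ)) :
    Nat.card (Quot (fun p q : Projectivization K (Fin 2 → K) =>
        ∃ (g : SL2 (𝓞 K)) (v : Fin 2 → K) (hv : v ≠ 0)
          (hw : (SLtoMat K g).mulVec v ≠ 0),
          p = Projectivization.mk K v hv ∧
          q = Projectivization.mk K ((SLtoMat K g).mulVec v) hw)) =
      NumberField.classNumber K := by
  classical
  set rel := (fun p q : Projectivization K (Fin 2 → K) =>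
        ∃ (g : SL2 (𝓞 K)) (v : Fin 2 → K) (hv : v ≠ 0)
          (hw : (SLtoMat K g).mulVec v ≠ 0),
          p = Projectivization.mk K v hv ∧
          q = Projectivization.mk K ((SLtoMat K g).mulVec v) hw) with hrel
  choose A B hAB hP using aux_rep K
  let f : Projectivization K (Fin 2 → K) → ClassGroup (𝓞 K) :=
    fun P => ClassGroup.mk0 ⟨_, aux_ne ((auxV_ne K).1 (hAB P))⟩
  have hf : ∀ P (a b : 𝓞 K) (h : auxV K a b ≠ 0), rel P (Projectivization.mk K _ h) ↔
      f P = ClassGroup.mk0 ⟨_, aux_ne ((auxV_ne K).1 h)⟩ := by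
    intro P a b h
    change _ ↔ ClassGroup.mk0 _ = ClassGroup.mk0 _
    rw [aux_iff ((auxV_ne K).1 (hAB P)) ((auxV_ne K).1 h), ← aux_rel K (hAB P) h, ← hP P]
  have hf2 : ∀ P Q, rel P Q ↔ f P = f Q := by
    intro P Q
    have := hf P _ _ (hAB Q)
    rwa [← hP Q] at this
  have hbij : Function.Bijective (Quot.lift f (fun P Q h => (hf2 P Q).1 h) : Quot rel → _) := by
    constructor
    · rintro ⟨P⟩ ⟨Q⟩ h
      exact Quot.sound ((hf2 P Q).2 h)
    · intro C
      obtain ⟨⟨I, hI⟩, rfl⟩ := ClassGroup.mk0_surjective C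
      have hI0 : I ≠ ⊥ := mem_nonZeroDivisors_iff_ne_zero.1 hI
      obtain ⟨x, hx, hx0⟩ := Submodule.exists_mem_ne_zero_of_ne_bot hI0
      obtain ⟨y, rfl⟩ := IsDedekindDomain.exists_eq_span_pair hx hx0
      have h : auxV K x y ≠ 0 := (auxV_ne K).2 (by simp [hx0])
      refine ⟨Quot.mk _ (Projectivization.mk K _ h), ?_⟩
      exact (hf _ x y h).1 ((hf2 _ _).2 rfl)
  rw [Nat.card_congr (Equiv.ofBijective _ hbij), NumberField.classNumber, Nat.card_eq_fintype_card]
end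

section
/- Let d be a squarefree positive integer and let O_d be the ring of integers of ℚ(√−d). Then O_d admits a Euclidean algorithm — that is, there exists a function f : O_d → ℕ such that for all a, b ∈ O_d with b ≠ 0 there exist q, r ∈ O_d with a = b·q + r and either r = 0 or f(r) < f(b) — if and only if d ∈ {1, 2, 3, 7, 11}. -/
open IntermediateField

/-- The imaginary quadratic field `ℚ(√-d)`, realized inside `ℂ`. -/
noncomputable abbrev Qd (d : ℕ) : IntermediateField ℚ ℂ :=
  ℚ⟮(Complex.I * (Real.sqrt d : ℂ) : ℂ)⟯

/-- `O_d`: the ring of integers of the imaginary quadratic field `ℚ(√-d)`. -/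
noncomputable abbrev Od (d : ℕ) : Type :=
  NumberField.RingOfIntegers (Qd d)

noncomputable def sd (d : ℕ) : ℂ := Complex.I * (Real.sqrt d : ℂ)

lemma sd_sq (d : ℕ) : sd d * sd d = -(d : ℂ) := by
  unfold sd
  have h : ((Real.sqrt d : ℝ) : ℂ) * (Real.sqrt d : ℂ) = (d : ℂ) := by
    rw [← Complex.ofReal_mul, Real.mul_self_sqrt (by positivity)]; simp
  linear_combination (Complex.I * Complex.I) * h + (d : ℂ) * Complex.I_mul_I

lemma sd_conj (d : ℕ) : (starRingEnd ℂ) (sd d) = - sd d := by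
  simp [sd]

lemma sd_re (d : ℕ) : (sd d).re = 0 := by simp [sd]
lemma sd_im (d : ℕ) : (sd d).im = Real.sqrt d := by simp [sd]

lemma Qd_mem (d : ℕ) (z : ℂ) (hz : z ∈ Qd d) : ∃ a b : ℚ, z = a + b * sd d := by
  induction hz using IntermediateField.adjoin_induction with
  | mem x hx =>
    rw [Set.mem_singleton_iff] at hx
    exact ⟨0, 1, by rw [hx]; simp [sd]⟩
  | algebraMap x => exact ⟨x, 0, by simp⟩
  | add x y _ _ h1 h2 =>
    obtain ⟨a, b, rfl⟩ := h1
    obtain ⟨a', b', rfl⟩ := h2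
    exact ⟨a + a', b + b', by push_cast; ring⟩
  | mul x y _ _ h1 h2 =>
    obtain ⟨a, b, rfl⟩ := h1
    obtain ⟨a', b', rfl⟩ := h2
    refine ⟨a * a' - d * b * b', a * b' + b * a', ?_⟩
    push_cast
    linear_combination (b * b' : ℂ) * sd_sq d
  | inv x _ h1 =>
    obtain ⟨a, b, rfl⟩ := h1
    by_cases h0 : (a + b * sd d : ℂ) = 0
    · exact ⟨0, 0, by rw [h0]; simp⟩
    · have h0' : (a - b * sd d : ℂ) ≠ 0 := by
        intro h
        apply h0
        have := congrArg (starRingEnd ℂ) h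
        simpa [sd_conj] using this
      have h2 : (a ^ 2 + d * b ^ 2 : ℂ) ≠ 0 := by
        have : (a ^ 2 + d * b ^ 2 : ℂ) = (a + b * sd d) * (a - b * sd d) := by
          linear_combination (b ^ 2 : ℂ) * sd_sq d
        rw [this]; exact mul_ne_zero h0 h0'
      refine ⟨a / (a ^ 2 + d * b ^ 2), - b / (a ^ 2 + d * b ^ 2), ?_⟩
      push_cast
      have h3 : (a / (a ^ 2 + d * b ^ 2) + -b / (a ^ 2 + d * b ^ 2) * sd d : ℂ) =
          (a - b * sd d) / (a ^ 2 + d * b ^ 2) := by ring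
      rw [h3]
      apply inv_eq_of_mul_eq_one_right
      rw [← mul_div_assoc, div_eq_one_iff_eq h2]
      linear_combination (-b ^ 2 : ℂ) * sd_sq d

def PO (d : ℕ) (z : ℂ) (x y : ℤ) : Prop := 2 * z = x + y * sd d ∧ (4 : ℤ) ∣ x ^ 2 + d * y ^ 2

lemma rat_int (q : ℚ) (h : IsIntegral ℤ (q : ℂ)) : ∃ n : ℤ, q = n := by
  have h1 : IsIntegral ℤ (algebraMap ℚ ℂ q) := by simpa using h
  rw [isIntegral_algebraMap_iff (algebraMap ℚ ℂ).injective] at h1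
  obtain ⟨n, hn⟩ := IsIntegrallyClosed.isIntegral_iff.mp h1
  exact ⟨n, by simpa using hn.symm⟩

lemma sqf_int (d : ℕ) (hd : Squarefree d) (c : ℚ) (m : ℤ) (h : (d : ℚ) * c ^ 2 = m) :
    ∃ n : ℤ, c = n := by
  have h1 : (d : ℤ) * c.num ^ 2 = m * (c.den : ℤ) ^ 2 := by
    have hden : (c.den : ℚ) ≠ 0 := by exact_mod_cast c.den_nz
    have hc : c = c.num / c.den := (Rat.num_div_den c).symm
    rw [hc] at h
    field_simp at h
    rw [mul_comm m]
    exact_mod_cast h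
  have h2 : d * c.num.natAbs ^ 2 = m.natAbs * c.den ^ 2 := by
    have := congrArg Int.natAbs h1
    simpa [Int.natAbs_mul, Int.natAbs_pow] using this
  have h3 : c.den ^ 2 ∣ d := by
    have : (c.den ^ 2).Coprime (c.num.natAbs ^ 2) := (Nat.Coprime.pow 2 2 c.reduced).symm
    exact this.dvd_of_dvd_mul_right ⟨m.natAbs, by rw [h2]; ring⟩
  have h4 : c.den = 1 := by
    have := hd c.den (by rwa [← sq])
    simpa using this
  exact ⟨c.num, by conv_lhs => rw [← Rat.num_div_den c, h4]
                   simp⟩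

lemma Od_P (d : ℕ) (hd : Squarefree d) (w : Od d) : ∃ x y : ℤ, PO d ((w : Qd d) : ℂ) x y := by
  obtain ⟨a, b, hab⟩ := Qd_mem d _ (w : Qd d).2
  have hi : IsIntegral ℤ ((w : Qd d) : ℂ) := by
    have h := NumberField.RingOfIntegers.isIntegral_coe w
    exact h.map ((Qd d).val.restrictScalars ℤ)
  rw [hab] at hi ⊢
  have hc : IsIntegral ℤ (a - b * sd d : ℂ) := by
    have := hi.map ((starRingEnd ℂ).toIntAlgHom)
    simpa [sd_conj, sub_eq_add_neg] using this
  have ht : IsIntegral ℤ ((2 * a : ℚ) : ℂ) := by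
    have := hi.add hc
    have e : ((2 * a : ℚ) : ℂ) = (a + b * sd d) + (a - b * sd d) := by push_cast; ring
    rwa [e]
  have hn : IsIntegral ℤ ((a ^ 2 + d * b ^ 2 : ℚ) : ℂ) := by
    have := hi.mul hc
    have e : ((a ^ 2 + d * b ^ 2 : ℚ) : ℂ) = (a + b * sd d) * (a - b * sd d) := by
      push_cast
      linear_combination (b ^ 2 : ℂ) * sd_sq d
    rwa [e]
  obtain ⟨x, hx⟩ := rat_int _ ht
  obtain ⟨n, hn⟩ := rat_int _ hn
  obtain ⟨y, hy⟩ := sqf_int d hd (2 * b) (4 * n - x ^ 2) (by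
    push_cast; rw [← hn, ← hx]; ring)
  refine ⟨x, y, ?_, n, ?_⟩
  · have hx' : (2 * a : ℂ) = x := by exact_mod_cast congrArg (Rat.cast : ℚ → ℂ) hx
    have hy' : (2 * b : ℂ) = y := by exact_mod_cast congrArg (Rat.cast : ℚ → ℂ) hy
    linear_combination hx' + sd d * hy'
  · have : ((x ^ 2 + d * y ^ 2 : ℤ) : ℚ) = (4 * n : ℤ) := by
      push_cast; rw [← hn, ← hx, ← hy]; ring
    exact_mod_cast this

lemma P_Od (d : ℕ) (z : ℂ) (x y : ℤ) (h : PO d z x y) : ∃ w : Od d, ((w : Qd d) : ℂ) = z := by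
  obtain ⟨h1, n, h2⟩ := h
  have hs : sd d ∈ Qd d := IntermediateField.mem_adjoin_simple_self ℚ _
  have hz : z ∈ Qd d := by
    have : z = ((x / 2 : ℚ) : ℂ) + ((y / 2 : ℚ) : ℂ) * sd d := by
      push_cast; linear_combination h1 / 2
    rw [this]
    exact add_mem (by simpa using (Qd d).algebraMap_mem (x / 2 : ℚ))
      (mul_mem (by simpa using (Qd d).algebraMap_mem (y / 2 : ℚ)) hs)
  have h2' : (x : ℂ) ^ 2 + d * y ^ 2 = 4 * n := by exact_mod_cast congrArg (Int.cast : ℤ → ℂ) h2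
  have hi : IsIntegral ℤ z := by
    refine ⟨Polynomial.X ^ 2 + (-Polynomial.C x * Polynomial.X + Polynomial.C n), ?_, ?_⟩
    · monicity!
    · simp only [Polynomial.eval₂_add, Polynomial.eval₂_mul, Polynomial.eval₂_neg,
        Polynomial.eval₂_pow, Polynomial.eval₂_X, Polynomial.eval₂_C]
      simp only [algebraMap_int_eq, eq_intCast]
      linear_combination (2 * z - x + y * sd d) / 4 * h1 + y ^ 2 / 4 * sd_sq d - h2' / 4
  have hi' : IsIntegral ℤ (⟨z, hz⟩ : Qd d) := by
    have h : IsIntegral ℤ (algebraMap (Qd d) ℂ ⟨z, hz⟩) := hi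
    rwa [isIntegral_algebraMap_iff (algebraMap (Qd d) ℂ).injective] at h
  exact ⟨⟨⟨z, hz⟩, hi'⟩, rfl⟩

lemma PO_re_im {d : ℕ} {z : ℂ} {x y : ℤ} (h : PO d z x y) :
    2 * z.re = x ∧ 2 * z.im = y * Real.sqrt d := by
  have h1 := congrArg Complex.re h.1
  have h2 := congrArg Complex.im h.1
  simp [sd_re, sd_im] at h1 h2
  exact ⟨h1, h2⟩

lemma PO_norm {d : ℕ} {z : ℂ} {x y : ℤ} (h : PO d z x y) :
    4 * Complex.normSq z = ((x ^ 2 + d * y ^ 2 : ℤ) : ℝ) := by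
  obtain ⟨h1, h2⟩ := PO_re_im h
  have hs : Real.sqrt d * Real.sqrt d = d := Real.mul_self_sqrt (by positivity)
  rw [Complex.normSq_apply]
  push_cast
  linear_combination (2 * z.re + x) * h1 + (2 * z.im + y * Real.sqrt d) * h2 + y ^ 2 * hs

lemma PO_nat {d : ℕ} {z : ℂ} {x y : ℤ} (h : PO d z x y) :
    ∃ n : ℕ, Complex.normSq z = n ∧ x ^ 2 + d * y ^ 2 = 4 * n := by
  obtain ⟨n, hn⟩ := h.2
  have h1 := PO_norm h
  rw [hn] at h1
  have : 0 ≤ n := by nlinarith [sq_nonneg x, sq_nonneg y, mul_nonneg (Int.natCast_nonneg d) (sq_nonneg y)]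
  lift n to ℕ using this
  exact ⟨n, by push_cast at h1; linarith, hn⟩

lemma approx (d : ℕ) (hd : d ∈ ({1, 2, 3, 7, 11} : Set ℕ)) (z : ℂ) :
    ∃ q : ℂ, (∃ x y : ℤ, PO d q x y) ∧ Complex.normSq (z - q) < 1 := by
  have hd0 : 0 < (d : ℝ) := by
    rcases hd with rfl | rfl | rfl | rfl | rfl <;> norm_num
  set t := Real.sqrt d with ht
  have ht0 : 0 < t := Real.sqrt_pos.mpr hd0
  have hs : t * t = d := Real.mul_self_sqrt hd0.le
  obtain ⟨β, hβ⟩ : ∃ β : ℝ, z.im = β * t := ⟨z.im / t, by field_simp⟩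
  have key : ∀ x y : ℤ, (4 : ℤ) ∣ x ^ 2 + d * y ^ 2 →
      (z.re - x / 2) ^ 2 + d * (β - y / 2) ^ 2 < 1 →
      ∃ q : ℂ, (∃ x y : ℤ, PO d q x y) ∧ Complex.normSq (z - q) < 1 := by
    intro x y h4 hlt
    refine ⟨(x + y * sd d) / 2, ⟨x, y, by ring, h4⟩, ?_⟩
    have hre : ((x + y * sd d) / 2 : ℂ).re = x / 2 := by simp [sd_re]
    have him : ((x + y * sd d) / 2 : ℂ).im = y * t / 2 := by simp [sd_im, ht]
    rw [Complex.normSq_apply, Complex.sub_re, Complex.sub_im, hre, him, hβ]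
    nlinarith
  by_cases h2 : d ≤ 2
  · have hd2 : (d : ℝ) ≤ 2 := by exact_mod_cast h2
    refine key (2 * round z.re) (2 * round β) ⟨(round z.re) ^ 2 + d * (round β) ^ 2, by ring⟩ ?_
    have e1 := abs_le.mp (abs_sub_round z.re)
    have e2 := abs_le.mp (abs_sub_round β)
    push_cast
    have f1 : (z.re - 2 * round z.re / 2) ^ 2 ≤ 1 / 4 := by nlinarith
    have f2 : (β - 2 * round β / 2) ^ 2 ≤ 1 / 4 := by nlinarith
    nlinarith
  · have hd11 : (d : ℝ) ≤ 11 := by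
      rcases hd with rfl | rfl | rfl | rfl | rfl <;> norm_num
    obtain ⟨m, hm⟩ : ∃ m : ℤ, (1 + d : ℤ) = 4 * m := by
      rcases hd with rfl | rfl | rfl | rfl | rfl
      · omega
      · omega
      · exact ⟨1, by norm_num⟩
      · exact ⟨2, by norm_num⟩
      · exact ⟨3, by norm_num⟩
    set y := round (2 * β) with hy
    set k := round (z.re - y / 2) with hk
    refine key (y + 2 * k) y ⟨m * y ^ 2 + y * k + k ^ 2, by linear_combination y ^ 2 * hm⟩ ?_
    have e1 := abs_le.mp (abs_sub_round (z.re - y / 2))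
    have e2 := abs_le.mp (abs_sub_round (2 * β))
    rw [← hk] at e1
    rw [← hy] at e2
    push_cast
    have f1 : (z.re - (y + 2 * k) / 2) ^ 2 ≤ 1 / 4 := by nlinarith
    have f2 : (β - y / 2) ^ 2 ≤ 1 / 16 := by nlinarith
    nlinarith

/-- the embedding -/
noncomputable def emb (d : ℕ) : Od d →+* ℂ :=
  (algebraMap (Qd d) ℂ).comp (algebraMap (Od d) (Qd d))

lemma emb_inj (d : ℕ) : Function.Injective (emb d) :=
  (algebraMap (Qd d) ℂ).injective.comp NumberField.RingOfIntegers.coe_injective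

lemma emb_P (d : ℕ) (hd : Squarefree d) (w : Od d) : ∃ x y : ℤ, PO d (emb d w) x y := Od_P d hd w

lemma P_emb (d : ℕ) (z : ℂ) (x y : ℤ) (h : PO d z x y) : ∃ w : Od d, emb d w = z := P_Od d z x y h

lemma PO_unique {d : ℕ} (hd0 : 0 < d) {z : ℂ} {x y x' y' : ℤ} (h : PO d z x y)
    (h' : PO d z x' y') : x = x' ∧ y = y' := by
  obtain ⟨h1, h2⟩ := PO_re_im h
  obtain ⟨h1', h2'⟩ := PO_re_im h'
  have ht0 : 0 < Real.sqrt d := Real.sqrt_pos.mpr (by exact_mod_cast hd0)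
  constructor
  · have : (x : ℝ) = x' := by linarith
    exact_mod_cast this
  · have : (y : ℝ) = y' := mul_right_cancel₀ ht0.ne' (by linarith)
    exact_mod_cast this

lemma unit_pm {d : ℕ} (hd5 : 5 ≤ d) (hd : Squarefree d) (w : Od d)
    (h : Complex.normSq (emb d w) = 1) : w = 1 ∨ w = -1 := by
  obtain ⟨x, y, hp⟩ := emb_P d hd w
  obtain ⟨n, hn, hxy⟩ := PO_nat hp
  have hn1 : n = 1 := by rw [h] at hn; exact_mod_cast hn.symm
  subst hn1
  have hd5' : (5 : ℤ) ≤ d := by exact_mod_cast hd5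
  have hy : y = 0 := by
    by_contra hy
    have : 1 ≤ y ^ 2 := by have := sq_pos_of_ne_zero (R := ℤ) hy; omega
    push_cast at hxy
    nlinarith [sq_nonneg x]
  subst hy
  have hx : (x - 2) * (x + 2) = 0 := by push_cast at hxy; linarith
  have h1 := hp.1
  rcases mul_eq_zero.mp hx with hx | hx
  · left
    apply emb_inj d
    have : x = 2 := by omega
    subst this
    rw [map_one]; push_cast at h1; linear_combination h1 / 2
  · right
    apply emb_inj d
    have : x = -2 := by omega
    subst this
    rw [map_neg, map_one]; push_cast at h1; linear_combination h1 / 2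

lemma nn {d : ℕ} (hd : Squarefree d) (w : Od d) : ∃ n : ℕ, Complex.normSq (emb d w) = n := by
  obtain ⟨x, y, hp⟩ := emb_P d hd w
  obtain ⟨n, hn, -⟩ := PO_nat hp
  exact ⟨n, hn⟩

/-- A divisor of a prime `p ∈ {2,3}` that's neither a unit nor associated has norm `p`. -/
lemma div_prime {d p : ℕ} (hp : p.Prime) (hd : Squarefree d) (hd5 : 5 ≤ d) (b c : Od d)
    (hb : ¬ IsUnit b) (h : (p : Od d) = b * c) :
    Complex.normSq (emb d b) = p ∨ b = p ∨ b = -p := by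
  obtain ⟨m, hm⟩ := nn hd b
  obtain ⟨n, hn⟩ := nn hd c
  have hmn : m * n = p ^ 2 := by
    have := congrArg (fun w => Complex.normSq (emb d w)) h
    simp only [map_mul, map_natCast, Complex.normSq_natCast, hm, hn] at this
    have : ((m * n : ℕ) : ℝ) = (p ^ 2 : ℕ) := by push_cast; rw [← this]; ring
    exact_mod_cast this
  obtain ⟨k, hk, hmk⟩ := (Nat.dvd_prime_pow hp).mp ⟨n, hmn.symm⟩
  have hp0 := hp.pos
  interval_cases k
  · exfalso
    apply hb
    rcases unit_pm hd5 hd b (by rw [hm, hmk]; simp) with rfl | rfl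
    · exact isUnit_one
    · exact isUnit_one.neg
  · left; rw [hm, hmk]; simp
  · have : n = 1 := by
      rw [hmk] at hmn
      exact Nat.eq_of_mul_eq_mul_left (by positivity : 0 < p ^ 2) (by rw [hmn]; ring)
    right
    rcases unit_pm hd5 hd c (by rw [hn, this]; simp) with rfl | rfl
    · left; rw [h]; simp
    · right; rw [h]; simp

lemma no_norm {d : ℕ} (hd : Squarefree d) (hd5 : 5 ≤ d) (h7 : d ≠ 7) (h11 : d ≠ 11) (b : Od d)
    (p : ℕ) (hp : p = 2 ∨ p = 3) : Complex.normSq (emb d b) ≠ p := by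
  intro h
  obtain ⟨x, y, hP⟩ := emb_P d hd b
  obtain ⟨n, hn, hxy⟩ := PO_nat hP
  have hnp : n = p := by rw [h] at hn; exact_mod_cast hn.symm
  subst hnp
  have h8 : d ≠ 8 := by rintro rfl; exact absurd (hd 2 ⟨2, rfl⟩) (by decide)
  have h9 : d ≠ 9 := by rintro rfl; exact absurd (hd 3 ⟨1, rfl⟩) (by decide)
  have h12 : d ≠ 12 := by rintro rfl; exact absurd (hd 2 ⟨3, rfl⟩) (by decide)
  have hd5' : (5 : ℤ) ≤ d := by exact_mod_cast hd5
  have hx0 := sq_nonneg x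
  have hx4 : x < 4 := by rcases hp with rfl | rfl <;> push_cast at hxy <;> nlinarith [sq_nonneg y]
  have hx4' : -4 < x := by rcases hp with rfl | rfl <;> push_cast at hxy <;> nlinarith [sq_nonneg y]
  have hy2 : y < 2 := by rcases hp with rfl | rfl <;> push_cast at hxy <;> nlinarith
  have hy2' : -2 < y := by rcases hp with rfl | rfl <;> push_cast at hxy <;> nlinarith
  rcases hp with rfl | rfl <;> interval_cases y <;> interval_cases x <;> push_cast at hxy <;> omega

lemma omega_not {d : ℕ} (hd : Squarefree d) (hd0 : 0 < d) :
    ∃ w : Od d, ∀ (p : ℕ) (c : Od d) (e : ℤ), (p = 2 ∨ p = 3) → w - e ≠ p * c := by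
  by_cases h4 : (4 : ℤ) ∣ 1 + d
  · have hP : PO d ((1 + sd d) / 2) 1 1 := ⟨by push_cast; ring, by simpa using h4⟩
    obtain ⟨w, hw⟩ := P_emb d _ _ _ hP
    refine ⟨w, fun p c e hp h => ?_⟩
    obtain ⟨u, v, hc⟩ := emb_P d hd c
    have h' := congrArg (emb d) h
    simp only [map_sub, map_mul, map_natCast, map_intCast, hw] at h'
    have h2 := congrArg Complex.im h'
    have h3 := (PO_re_im hc).2
    have ht0 : 0 < Real.sqrt d := Real.sqrt_pos.mpr (by exact_mod_cast hd0)
    simp [sd_im] at h2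
    have : (1 : ℝ) = p * v := mul_right_cancel₀ ht0.ne' (by linear_combination 2 * h2 + p * h3)
    have : (1 : ℤ) = p * v := by exact_mod_cast this
    rcases hp with rfl | rfl <;> push_cast at this <;> omega
  · have hP : PO d (sd d) 0 2 := ⟨by push_cast; ring, ⟨d, by ring⟩⟩
    obtain ⟨w, hw⟩ := P_emb d _ _ _ hP
    refine ⟨w, fun p c e hp h => ?_⟩
    obtain ⟨u, v, hc⟩ := emb_P d hd c
    have h' := congrArg (emb d) h
    simp only [map_sub, map_mul, map_natCast, map_intCast, hw] at h'
    have h2 := congrArg Complex.im h'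
    have h3 := (PO_re_im hc).2
    have ht0 : 0 < Real.sqrt d := Real.sqrt_pos.mpr (by exact_mod_cast hd0)
    simp [sd_im] at h2
    have : (2 : ℝ) = p * v := mul_right_cancel₀ ht0.ne' (by linear_combination 2 * h2 + p * h3)
    have : (2 : ℤ) = p * v := by exact_mod_cast this
    rcases hp with rfl | rfl
    · have hv : v = 1 := by push_cast at this; omega
      have h5 := hc.2
      rw [hv] at h5
      rcases Int.even_or_odd' u with ⟨k, rfl | rfl⟩
      · have : (4 : ℤ) ∣ d := by
          have h6 : (4 : ℤ) ∣ 4 * k ^ 2 := ⟨_, rfl⟩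
          have := dvd_sub h5 h6
          ring_nf at this
          exact this
        have : 4 ∣ d := by exact_mod_cast this
        exact absurd (hd 2 this) (by decide)
      · apply h4
        have h6 : (4 : ℤ) ∣ 4 * (k ^ 2 + k) := ⟨_, rfl⟩
        have := dvd_sub h5 h6
        ring_nf at this
        exact this
    · push_cast at this; omega

/-- The ring of integers `O_d` of `ℚ(√-d)`, for `d` a squarefree positive integer, admits
a Euclidean algorithm if and only if `d ∈ {1, 2, 3, 7, 11}`. -/
theorem imaginary_quadratic_euclidean_iff (d : ℕ) (hd : Squarefree d) (hd0 : 0 < d) :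
    (∃ f : Od d → ℕ, ∀ a b : Od d, b ≠ 0 →
        ∃ q r : Od d, a = b * q + r ∧ (r = 0 ∨ f r < f b)) ↔
      d ∈ ({1, 2, 3, 7, 11} : Set ℕ) := by
  constructor
  · rintro ⟨f, hf⟩
    by_contra hmem
    simp only [Set.mem_insert_iff, Set.mem_singleton_iff, not_or] at hmem
    obtain ⟨h1, h2, h3, h7, h11⟩ := hmem
    have h4 : d ≠ 4 := by rintro rfl; exact absurd (hd 2 ⟨1, rfl⟩) (by decide)
    have hd5 : 5 ≤ d := by omega
    have unit_norm : ∀ u : Od d, IsUnit u → u = 1 ∨ u = -1 := by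
      intro u hu
      apply unit_pm hd5 hd
      obtain ⟨v, hv⟩ := hu.exists_right_inv
      obtain ⟨m, hm⟩ := nn hd u
      obtain ⟨n, hn⟩ := nn hd v
      have := congrArg (fun w => Complex.normSq (emb d w)) hv
      simp only [map_mul, map_one, hm, hn] at this
      have : m * n = 1 := by exact_mod_cast this
      rw [hm, Nat.eq_one_of_mul_eq_one_right this]; simp
    have hchar : ∀ n : ℕ, (n : Od d) = 0 → n = 0 := by
      intro n hn
      have := congrArg (emb d) hn
      simpa using this
    have two_ne : ((2 : ℕ) : Od d) ≠ 0 := fun h => by simpa using hchar 2 h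
    have two_nu : ¬ IsUnit ((2 : ℕ) : Od d) := by
      intro h
      rcases unit_norm _ h with h | h
      · have := congrArg (emb d) h
        simp only [map_natCast, map_one, map_neg] at this
        norm_num [Complex.ext_iff] at this
      · have := congrArg (emb d) h
        simp only [map_natCast, map_one, map_neg] at this
        norm_num [Complex.ext_iff] at this
    -- minimal nonunit
    have hex : ∃ n : ℕ, ∃ b : Od d, b ≠ 0 ∧ ¬ IsUnit b ∧ f b = n := ⟨_, _, two_ne, two_nu, rfl⟩
    classical
    obtain ⟨b, hb0, hbu, hbf⟩ := Nat.find_spec hex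
    have hmin : ∀ r : Od d, f r < f b → r = 0 ∨ r = 1 ∨ r = -1 := by
      intro r hr
      by_cases h0 : r = 0
      · exact Or.inl h0
      · right
        apply unit_norm
        by_contra hu
        rw [hbf] at hr
        exact Nat.find_min hex hr ⟨r, h0, hu, rfl⟩
    have hres : ∀ a : Od d, ∃ q : Od d, ∃ e : ℤ, a - e = b * q ∧ (e = 0 ∨ e = 1 ∨ e = -1) := by
      intro a
      obtain ⟨q, r, haq, hr⟩ := hf a b hb0
      have : r = 0 ∨ r = 1 ∨ r = -1 := by
        rcases hr with hr | hr
        · exact Or.inl hr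
        · exact hmin r hr
      rcases this with rfl | rfl | rfl
      · exact ⟨q, 0, by rw [haq]; simp, by simp⟩
      · exact ⟨q, 1, by rw [haq]; simp, by simp⟩
      · exact ⟨q, -1, by rw [haq]; simp, by simp⟩
    have hp : ∃ p : ℕ, (p = 2 ∨ p = 3) ∧ ∃ c, (p : Od d) = b * c := by
      obtain ⟨q, e, hq, he⟩ := hres 2
      rcases he with rfl | rfl | rfl
      · exact ⟨2, by simp, q, by rw [← hq]; push_cast; ring⟩
      · exfalso; apply hbu
        refine IsUnit.of_mul_eq_one q ?_
        rw [← hq]; push_cast; ring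
      · exact ⟨3, by simp, q, by rw [← hq]; push_cast; ring⟩
    obtain ⟨p, hp, c, hpc⟩ := hp
    have hpp : p.Prime := by rcases hp with rfl | rfl <;> norm_num
    obtain ⟨w, hw⟩ := omega_not hd hd0
    obtain ⟨q, e, hq, -⟩ := hres w
    rcases div_prime hpp hd hd5 b c hbu hpc with h | h | h
    · exact no_norm hd hd5 h7 h11 b p hp h
    · exact hw p q e hp (by rw [hq, h])
    · exact hw p (-q) e hp (by rw [hq, h]; ring)
  · intro hmem
    choose f hf using fun w : Od d => nn hd w
    refine ⟨f, fun a b hb => ?_⟩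
    have hb' : emb d b ≠ 0 := fun h => hb (emb_inj d (by rw [h, map_zero]))
    obtain ⟨q, ⟨x, y, hP⟩, hlt⟩ := approx d hmem (emb d a / emb d b)
    obtain ⟨w, hw⟩ := P_emb d _ _ _ hP
    refine ⟨w, a - b * w, by ring, Or.inr ?_⟩
    have h1 : emb d (a - b * w) = emb d b * (emb d a / emb d b - q) := by
      rw [map_sub, map_mul, hw]; field_simp
    have h2 : (f (a - b * w) : ℝ) < f b := by
      rw [← hf, ← hf, h1, map_mul]
      have := Complex.normSq_pos.mpr hb'
      nlinarith
    exact_mod_cast h2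
end
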